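/- arXiv:1605.09052 — 2 statements merged into one kernel-verified Lean document; each statement's English description precedes it below -/
import Mathlib

section
/- Main theorem (multinomial form): Let a_1,...,a_n > 0 be such that at least one ratio a_i/a_j is irrational and ∑_{i=1}^n p_i = 1 where p_i = e^{-a_i}. Let Q(z) = ∑_{k ∈ ℤ_{≥0}^n, ∑ a_i k_i ≤ z} (k_1+...+k_n)!/(k_1!···k_n!). Then lim_{z→∞} Q(z)/e^z = 1/H(p), where H(p) = ∑_{i=1}^n a_i p_i = -∑ p_i ln p_i. -/
/-- `wordCount n a z` sums multinomial coefficients over the lattice points of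
the simplex `{x ≥ 0 : ∑ a i * x i ≤ z}`. -/
noncomputable def wordCount (n : ℕ) (a : Fin n → ℝ) (z : ℝ) : ℝ :=
  ∑' k : {k : Fin n → ℕ // ∑ i, a i * (k i : ℝ) ≤ z},
    (Nat.multinomial Finset.univ k.1 : ℝ)

open Filter Topology

/-- A submonoid of `ℝ` containing two positive elements at distance less than `ε` meets every
interval `(x - ε, x]` far enough to the right. -/
lemma AddSubmonoid.exists_mem_Ioc_of_lt_add {S : AddSubmonoid ℝ} {u v ε : ℝ} (hu : u ∈ S)
    (hv : v ∈ S) (hv0 : 0 < v) (hvu : v < u) (huv : u < v + ε) :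
    ∃ T, ∀ x ≥ T, ∃ s ∈ S, x - ε < s ∧ s ≤ x := by
  have hd : 0 < u - v := sub_pos.2 hvu
  obtain ⟨K, hK⟩ := exists_nat_ge (v / (u - v))
  refine ⟨K * v, fun x hx => ?_⟩
  have hy : 0 ≤ x - K * v := sub_nonneg.2 hx
  set m := ⌊(x - K * v) / v⌋₊ with hm
  have hm1 : (m : ℝ) * v ≤ x - K * v := (le_div_iff₀ hv0).1 (Nat.floor_le (by positivity))
  have hm2 : x - K * v < (m + 1) * v := (div_lt_iff₀ hv0).1 (Nat.lt_floor_add_one _)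
  have hr : 0 ≤ x - K * v - m * v := sub_nonneg.2 hm1
  set k := ⌊(x - K * v - m * v) / (u - v)⌋₊ with hk
  have hk1 : (k : ℝ) * (u - v) ≤ x - K * v - m * v :=
    (le_div_iff₀ hd).1 (Nat.floor_le (by positivity))
  have hk2 : x - K * v - m * v < (k + 1) * (u - v) :=
    (div_lt_iff₀ hd).1 (Nat.lt_floor_add_one _)
  have hkK : k ≤ K := by
    have h : (k : ℝ) ≤ K := by
      refine le_trans ?_ hK
      rw [le_div_iff₀ hd]
      linarith
    exact_mod_cast h
  refine ⟨(m + (K - k) : ℕ) • v + k • u, S.add_mem (S.nsmul_mem hv _) (S.nsmul_mem hu _), ?_, ?_⟩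
  all_goals
    simp only [nsmul_eq_mul, Nat.cast_add, Nat.cast_sub hkK]
    linarith

lemma AddSubmonoid.exists_mem_Ioc_of_irrational {S : AddSubmonoid ℝ} {a b : ℝ} (ha : a ∈ S)
    (hb : b ∈ S) (ha0 : 0 < a) (hb0 : 0 < b) (hab : Irrational (a / b)) {ε : ℝ} (hε : 0 < ε) :
    ∃ T, ∀ x ≥ T, ∃ s ∈ S, x - ε < s ∧ s ≤ x := by
  have hdense := dense_addSubgroupClosure_pair_iff.2 hab
  obtain ⟨d, hd, hd0, hd1⟩ :=
    hdense.exists_between (show (0 : ℝ) < min ε (min a b) by positivity)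
  obtain ⟨m, k, rfl⟩ := AddSubgroup.mem_closure_pair.1 hd
  simp only [lt_min_iff, zsmul_eq_mul] at hd0 hd1
  obtain ⟨h1, h2, h3⟩ := hd1
  have pos_or {m k : ℤ} {a b : ℝ} (ha : a ∈ S) (hb : b ∈ S) (hb0 : 0 < b) (hm : 0 ≤ m)
      (hk : k < 0) (h0 : 0 < m * a + k * b) (h1 : m * a + k * b < ε) :
      ∃ T, ∀ x ≥ T, ∃ s ∈ S, x - ε < s ∧ s ≤ x := by
    lift m to ℕ using hm
    obtain ⟨k, rfl⟩ : ∃ j : ℕ, k = -j := ⟨(-k).toNat, by omega⟩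
    have hk0 : (0 : ℝ) < k := by
      have : 0 < k := by omega
      exact_mod_cast this
    push_cast at h0 h1
    have hkb : 0 < (k : ℝ) * b := by positivity
    refine AddSubmonoid.exists_mem_Ioc_of_lt_add (u := m • a) (v := k • b) (S.nsmul_mem ha _)
      (S.nsmul_mem hb _) ?_ ?_ ?_ <;> simp only [nsmul_eq_mul] <;> linarith
  rcases lt_or_ge k 0 with hk | hk
  · rcases lt_or_ge m 0 with hm | hm
    · have : (m : ℝ) < 0 := by exact_mod_cast hm
      have : (k : ℝ) < 0 := by exact_mod_cast hk
      nlinarith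
    · exact pos_or ha hb hb0 hm hk hd0 h1
  · rcases lt_or_ge m 0 with hm | hm
    · exact pos_or hb ha ha0 hk hm (by linarith) (by linarith)
    · have hk' : (0 : ℝ) ≤ k := by exact_mod_cast hk
      have hm' : (0 : ℝ) ≤ m := by exact_mod_cast hm
      rcases hk.eq_or_lt with rfl | hk
      · rcases hm.eq_or_lt with rfl | hm
        · simp at hd0
        · have : (1 : ℝ) ≤ m := by exact_mod_cast hm
          nlinarith
      · have : (1 : ℝ) ≤ k := by exact_mod_cast hk
        nlinarith

/-- Finitely many elements of the submonoid already approximate a whole window. -/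
lemma exists_finset_approx {S : AddSubmonoid ℝ} {ε T : ℝ} (hε : 0 < ε)
    (hT : ∀ x ≥ T, ∃ s ∈ S, x - ε < s ∧ s ≤ x) (A : ℝ) :
    ∃ t : Finset ℝ, (∀ s ∈ t, s ∈ S) ∧
      ∀ x ∈ Set.Icc T (T + A), ∃ s ∈ t, x ≤ s ∧ s ≤ x + 2 * ε := by
  choose! f hfS hf1 hf2 using hT
  refine ⟨(Finset.range (⌈A / ε⌉₊ + 2)).image fun j : ℕ => f (T + j * ε), ?_, ?_⟩
  · simp only [Finset.mem_image]
    rintro _ ⟨j, -, rfl⟩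
    exact hfS _ (by have : 0 ≤ (j : ℝ) * ε := by positivity
                    linarith)
  · intro x hx
    have hxT : 0 ≤ x - T := sub_nonneg.2 hx.1
    have h1 : x - T ≤ ⌈(x - T) / ε⌉₊ * ε := (div_le_iff₀ hε).1 (Nat.le_ceil _)
    have h2 : (⌈(x - T) / ε⌉₊ : ℝ) * ε < x - T + ε := by
      have := mul_lt_mul_of_pos_right (Nat.ceil_lt_add_one (div_nonneg hxT hε.le)) hε
      rwa [add_mul, div_mul_cancel₀ _ hε.ne', one_mul] at this
    have hle : ⌈(x - T) / ε⌉₊ ≤ ⌈A / ε⌉₊ :=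
      Nat.ceil_mono (div_le_div_of_nonneg_right (by linarith [hx.2]) hε.le)
    have hge : T + ((⌈(x - T) / ε⌉₊ + 1 : ℕ) : ℝ) * ε ≥ T := by
      have : 0 ≤ ((⌈(x - T) / ε⌉₊ + 1 : ℕ) : ℝ) * ε := by positivity
      linarith
    refine ⟨_, Finset.mem_image_of_mem _
      (Finset.mem_range.2 (show ⌈(x - T) / ε⌉₊ + 1 < _ by omega)), ?_, ?_⟩
    · have := hf1 _ hge
      push_cast at this ⊢
      linarith
    · have := hf2 _ hge
      push_cast at this ⊢
      linarith

section Renewal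

variable {ι : Type*} [Fintype ι] {a p : ι → ℝ} {F : ℝ → ℝ} {L : ℝ}

/-- Near-maximal values of an asymptotic solution of the renewal equation propagate backwards along
the semigroup generated by the steps. -/
lemma eventually_near_limsup_sub (hp : ∀ i, 0 < p i) (hp1 : ∑ i, p i = 1)
    (hF : Tendsto (fun z => F z - ∑ i, p i * F (z - a i)) atTop (𝓝 0))
    (hup : ∀ ε > 0, ∀ᶠ z in atTop, F z < L + ε) {s : ℝ}
    (hs : s ∈ AddSubmonoid.closure (Set.range a)) :
    ∀ ε > 0, ∃ δ > 0, ∀ᶠ z in atTop, L - δ < F z → L - ε < F (z - s) := by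
  induction hs using AddSubmonoid.closure_induction with
  | mem x hx =>
    obtain ⟨i, rfl⟩ := hx
    intro ε hε
    have hδ : 0 < p i * ε / 3 := by have := hp i; positivity
    have hall : ∀ᶠ z in atTop, ∀ j, F (z - a j) < L + p i * ε / 3 := by
      rw [eventually_all]
      intro j
      exact (tendsto_atTop_add_const_right atTop (-a j) tendsto_id).eventually (hup _ hδ)
    refine ⟨p i * ε / 3, hδ, ?_⟩
    filter_upwards [hall, hF.eventually_lt_const hδ] with z h1 h2 h3
    classical
    rw [← Finset.add_sum_erase _ _ (Finset.mem_univ i)] at h2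
    have hp2 : p i + ∑ j ∈ Finset.univ.erase i, p j = 1 := by
      rw [Finset.add_sum_erase _ _ (Finset.mem_univ i), hp1]
    have h4 : ∑ j ∈ Finset.univ.erase i, p j * F (z - a j) ≤
        (∑ j ∈ Finset.univ.erase i, p j) * (L + p i * ε / 3) := by
      rw [Finset.sum_mul]
      exact Finset.sum_le_sum fun j _ => mul_le_mul_of_nonneg_left (h1 j).le (hp j).le
    rw [show ∑ j ∈ Finset.univ.erase i, p j = 1 - p i by linarith] at h4
    refine lt_of_mul_lt_mul_left (a := p i) ?_ (hp i).le
    have := mul_pos (hp i) hδ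
    nlinarith
  | zero => exact fun ε hε => ⟨ε, hε, by simp⟩
  | add x y _ _ hx hy =>
    intro ε hε
    obtain ⟨δ, hδ, h1⟩ := hy ε hε
    obtain ⟨η, hη, h2⟩ := hx δ hδ
    refine ⟨η, hη, ?_⟩
    filter_upwards [h2, (tendsto_atTop_add_const_right atTop (-x) tendsto_id).eventually h1]
      with z h3 h4 h5
    have := h4 (h3 h5)
    simpa [sub_eq_add_neg, add_assoc, add_comm, add_left_comm] using this

lemma exists_near_limsup_finset (hp : ∀ i, 0 < p i) (hp1 : ∑ i, p i = 1)
    (hF : Tendsto (fun z => F z - ∑ i, p i * F (z - a i)) atTop (𝓝 0))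
    (hup : ∀ ε > 0, ∀ᶠ z in atTop, F z < L + ε)
    (hfr : ∀ ε > 0, ∃ᶠ z in atTop, L - ε < F z) (t : Finset ℝ)
    (ht : ∀ s ∈ t, s ∈ AddSubmonoid.closure (Set.range a)) {ε : ℝ} (hε : 0 < ε) (R : ℝ) :
    ∃ z ≥ R, ∀ s ∈ t, L - ε < F (z - s) := by
  have key : ∃ δ > 0, ∀ᶠ z in atTop, L - δ < F z → ∀ s ∈ t, L - ε < F (z - s) := by
    induction t using Finset.induction_on with
    | empty => exact ⟨1, one_pos, by simp⟩
    | insert s t _ ih =>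
      obtain ⟨δ, hδ, h1⟩ := ih fun s hs => ht s (Finset.mem_insert_of_mem hs)
      obtain ⟨η, hη, h2⟩ :=
        eventually_near_limsup_sub hp hp1 hF hup (ht s (Finset.mem_insert_self _ _)) ε hε
      refine ⟨min δ η, lt_min hδ hη, ?_⟩
      filter_upwards [h1, h2] with z h1 h2 h3
      have := min_le_left δ η
      have := min_le_right δ η
      exact Finset.forall_mem_insert _ _ _ |>.2 ⟨h2 (by linarith), h1 (by linarith)⟩
  obtain ⟨δ, hδ, h⟩ := key
  obtain ⟨z, h1, h2, h3⟩ := ((hfr δ hδ).and_eventually (h.and (eventually_ge_atTop R))).exists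
  exact ⟨z, h3, h2 h1⟩

/-- For non-lattice steps, arbitrarily far out there are windows of any prescribed length on which
near-maximal values are `ε`-dense. -/
lemma exists_window_near_limsup (ha : ∀ i, 0 < a i) (hirr : ∃ i j, Irrational (a i / a j))
    (hp : ∀ i, 0 < p i) (hp1 : ∑ i, p i = 1)
    (hF : Tendsto (fun z => F z - ∑ i, p i * F (z - a i)) atTop (𝓝 0))
    (hup : ∀ ε > 0, ∀ᶠ z in atTop, F z < L + ε)
    (hfr : ∀ ε > 0, ∃ᶠ z in atTop, L - ε < F z) {ε : ℝ} (hε : 0 < ε) (A R : ℝ) :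
    ∃ z ≥ R, ∀ y ∈ Set.Icc z (z + A), ∃ y' ∈ Set.Icc (y - ε) y, L - ε < F y' := by
  obtain ⟨i, j, hij⟩ := hirr
  obtain ⟨T, hT⟩ := AddSubmonoid.exists_mem_Ioc_of_irrational
    (AddSubmonoid.subset_closure (Set.mem_range_self i))
    (AddSubmonoid.subset_closure (Set.mem_range_self j)) (ha i) (ha j) hij (half_pos hε)
  obtain ⟨t, ht, happ⟩ := exists_finset_approx (half_pos hε) hT A
  obtain ⟨z, hz, h⟩ := exists_near_limsup_finset hp hp1 hF hup hfr t ht hε (R + T + A)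
  refine ⟨z - T - A, by linarith, fun y hy => ?_⟩
  obtain ⟨s, hs, h1, h2⟩ := happ (z - y) ⟨by linarith [hy.2], by linarith [hy.1]⟩
  exact ⟨z - s, ⟨by linarith, by linarith⟩, h s hs⟩

end Renewal

lemma Nat.multinomial_eq_sum_pred {ι : Type*} [Fintype ι] [DecidableEq ι] {k : ι → ℕ}
    (hk : k ≠ 0) :
    Nat.multinomial Finset.univ k =
      ∑ i with 0 < k i, Nat.multinomial Finset.univ (k - Pi.single i 1) := by
  have hpos : 0 < ∏ i, (k i).factorial := Finset.prod_pos fun i _ => Nat.factorial_pos _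
  have hsum : 0 < ∑ i, k i := by
    obtain ⟨i, hi⟩ := Function.ne_iff.1 hk
    exact Finset.sum_pos' (fun _ _ => Nat.zero_le _) ⟨i, Finset.mem_univ i, Nat.pos_of_ne_zero hi⟩
  refine Nat.eq_of_mul_eq_mul_left hpos ?_
  rw [Nat.multinomial_spec, Finset.mul_sum]
  have key : ∀ i ∈ Finset.univ.filter (fun i => 0 < k i),
      (∏ j, (k j).factorial) * Nat.multinomial Finset.univ (k - Pi.single i 1) =
        k i * (∑ j, k j - 1).factorial := by
    intro i hi
    have hi : 0 < k i := (Finset.mem_filter.1 hi).2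
    have hupd : k - Pi.single i 1 = Function.update k i (k i - 1) := by
      ext j
      rcases eq_or_ne j i with rfl | hj <;> simp [*]
    have h1 : ∑ j, (k - Pi.single i 1 : ι → ℕ) j = ∑ j, k j - 1 := by
      rw [hupd, Finset.sum_update_of_mem (Finset.mem_univ i),
        ← Finset.sum_sdiff (Finset.subset_univ {i}), Finset.sum_singleton]
      omega
    have h2 : ∏ j, (k j).factorial = k i * ∏ j, ((k - Pi.single i 1 : ι → ℕ) j).factorial := by
      have h3 : (fun j => (Function.update k i (k i - 1) j).factorial) =
          Function.update (fun j => (k j).factorial) i (k i - 1).factorial := by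
        ext j
        rcases eq_or_ne j i with rfl | hj <;> simp [*]
      rw [hupd, h3, Finset.prod_update_of_mem (Finset.mem_univ i), ← mul_assoc,
        Nat.mul_factorial_pred hi.ne', ← Finset.prod_sdiff (Finset.subset_univ {i}),
        Finset.prod_singleton, mul_comm]
    rw [h2, mul_assoc, Nat.multinomial_spec, h1]
  rw [Finset.sum_congr rfl key, ← Finset.sum_mul]
  have : ∑ i with 0 < k i, k i = ∑ i, k i := by
    refine Finset.sum_filter_of_ne fun i _ h => Nat.pos_of_ne_zero h
  rw [this, Nat.mul_factorial_pred hsum.ne']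

section WordCount

variable {n : ℕ} {a : Fin n → ℝ}

lemma exists_finset_simplex (ha : ∀ i, 0 < a i) (z : ℝ) :
    ∃ t : Finset (Fin n → ℕ), ∀ k, k ∈ t ↔ ∑ i, a i * (k i : ℝ) ≤ z := by
  have hfin : {k : Fin n → ℕ | ∑ i, a i * (k i : ℝ) ≤ z}.Finite := by
    refine (Set.finite_Iic fun i => ⌊z / a i⌋₊).subset fun k hk i => Nat.le_floor ?_
    rw [le_div_iff₀ (ha i), mul_comm]
    exact (Finset.single_le_sum (f := fun i => a i * (k i : ℝ))
      (fun j _ => mul_nonneg (ha j).le (Nat.cast_nonneg _)) (Finset.mem_univ i)).trans hk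
  exact ⟨hfin.toFinset, fun k => by simp⟩

lemma wordCount_eq_sum {z : ℝ} {t : Finset (Fin n → ℕ)}
    (ht : ∀ k, k ∈ t ↔ ∑ i, a i * (k i : ℝ) ≤ z) :
    wordCount n a z = ∑ k ∈ t, (Nat.multinomial Finset.univ k : ℝ) := by
  have h : {k : Fin n → ℕ | ∑ i, a i * (k i : ℝ) ≤ z} = t := by
    ext k
    simp [ht]
  rw [← Finset.tsum_subtype' t fun k => (Nat.multinomial Finset.univ k : ℝ), ← h]
  rfl

lemma wordCount_nonneg (n : ℕ) (a : Fin n → ℝ) (z : ℝ) : 0 ≤ wordCount n a z :=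
  tsum_nonneg fun _ => Nat.cast_nonneg _

lemma wordCount_of_neg (ha : ∀ i, 0 < a i) {z : ℝ} (hz : z < 0) : wordCount n a z = 0 := by
  rw [wordCount_eq_sum (t := ∅), Finset.sum_empty]
  intro k
  simp only [Finset.notMem_empty, false_iff, not_le]
  exact hz.trans_le (Finset.sum_nonneg fun i _ => mul_nonneg (ha i).le (Nat.cast_nonneg _))

lemma wordCount_mono (ha : ∀ i, 0 < a i) : Monotone (wordCount n a) := by
  intro y z hyz
  obtain ⟨s, hs⟩ := exists_finset_simplex ha y
  obtain ⟨t, ht⟩ := exists_finset_simplex ha z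
  rw [wordCount_eq_sum hs, wordCount_eq_sum ht]
  exact Finset.sum_le_sum_of_subset_of_nonneg
    (fun k hk => (ht k).2 (((hs k).1 hk).trans hyz)) fun _ _ _ => Nat.cast_nonneg _

/-- The renewal equation for `wordCount`. -/
lemma wordCount_eq_one_add (ha : ∀ i, 0 < a i) {z : ℝ} (hz : 0 ≤ z) :
    wordCount n a z = 1 + ∑ i, wordCount n a (z - a i) := by
  classical
  obtain ⟨t, ht⟩ := exists_finset_simplex ha z
  have h0 : (0 : Fin n → ℕ) ∈ t := (ht 0).2 (by simpa using hz)
  rw [wordCount_eq_sum ht, ← Finset.add_sum_erase _ _ h0]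
  congr 1
  · have := Nat.multinomial_spec Finset.univ (0 : Fin n → ℕ)
    simp at this
    simp [this]
  · have h1 : ∀ k ∈ t.erase 0, (Nat.multinomial Finset.univ k : ℝ) =
        ∑ i with 0 < k i, (Nat.multinomial Finset.univ (k - Pi.single i 1) : ℝ) := by
      intro k hk
      rw [Nat.multinomial_eq_sum_pred (Finset.mem_erase.1 hk).1, Nat.cast_sum]
    rw [Finset.sum_congr rfl h1, Finset.sum_comm' (t' := Finset.univ)
      (s' := fun i => t.filter fun k => 0 < k i)]
    · refine Finset.sum_congr rfl fun i _ => ?_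
      have hs : ∀ k : Fin n → ℕ, k ∈ (t.filter fun k => 0 < k i).image (· - Pi.single i 1) ↔
          ∑ j, a j * (k j : ℝ) ≤ z - a i := by
        have hadd : ∀ k : Fin n → ℕ, ∑ j, a j * ((k + Pi.single i 1 : Fin n → ℕ) j : ℝ) =
            ∑ j, a j * (k j : ℝ) + a i := by
          intro k
          simp [mul_add, Finset.sum_add_distrib, Pi.single_apply]
        intro k
        simp only [Finset.mem_image, Finset.mem_filter, ht]
        constructor
        · rintro ⟨k, ⟨hk, hki⟩, rfl⟩
          rw [le_sub_iff_add_le, ← hadd, tsub_add_cancel_of_le]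
          · exact hk
          · intro j
            rcases eq_or_ne j i with rfl | hj
            · simpa [Nat.one_le_iff_ne_zero, Nat.pos_iff_ne_zero] using hki
            · simp [hj]
        · intro hk
          exact ⟨k + Pi.single i 1, ⟨by rw [hadd]; linarith, by simp⟩, by simp⟩
      rw [wordCount_eq_sum hs, Finset.sum_image]
      intro k hk l hl hkl
      simp only [Finset.coe_filter, Set.mem_ofPred_eq] at hk hl
      ext j
      have := congrFun hkl j
      rcases eq_or_ne j i with rfl | hj
      · simp at this
        omega
      · simpa [hj] using this
    · intro k i
      simp only [Finset.mem_erase, Finset.mem_filter, Finset.mem_univ, true_and, and_true]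
      constructor
      · rintro ⟨⟨-, h⟩, h'⟩
        exact ⟨h, h'⟩
      · rintro ⟨h, h'⟩
        exact ⟨⟨fun h0 => by simp [h0] at h', h⟩, h'⟩

lemma wordCount_le_exp (hn : 2 ≤ n) (ha : ∀ i, 0 < a i) (hsum : ∑ i, Real.exp (-a i) = 1) :
    ∃ C, ∀ z, wordCount n a z ≤ C * Real.exp z := by
  have : Nonempty (Fin n) := ⟨⟨0, by omega⟩⟩
  obtain ⟨i₀, hmin⟩ := Finite.exists_min a
  obtain ⟨i₁, hmax⟩ := Finite.exists_max a
  have key : ∀ m : ℕ, ∀ z, -a i₁ ≤ z → z < m * a i₀ →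
      wordCount n a z ≤ Real.exp (a i₁) * Real.exp z - 1 := by
    intro m
    induction m with
    | zero =>
      intro z h1 h2
      rw [wordCount_of_neg ha (by simpa using h2), ← Real.exp_add, sub_nonneg]
      exact Real.one_le_exp (by linarith)
    | succ m ih =>
      intro z h1 h2
      rcases lt_or_ge z 0 with hz | hz
      · rw [wordCount_of_neg ha hz, ← Real.exp_add, sub_nonneg]
        exact Real.one_le_exp (by linarith)
      · push_cast at h2
        rw [wordCount_eq_one_add ha hz]
        have hle : ∑ i, wordCount n a (z - a i) ≤
            ∑ i, (Real.exp (a i₁) * Real.exp (z - a i) - 1) :=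
          Finset.sum_le_sum fun i _ =>
            ih _ (by linarith [hmax i]) (by linarith [hmin i])
        have heq : ∑ i, (Real.exp (a i₁) * Real.exp (z - a i) - 1) =
            Real.exp (a i₁) * Real.exp z - n := by
          simp only [sub_eq_add_neg, Real.exp_add, Finset.sum_add_distrib, ← Finset.mul_sum,
            hsum]
          simp
        have : (2 : ℝ) ≤ n := by exact_mod_cast hn
        linarith
  refine ⟨Real.exp (a i₁), fun z => ?_⟩
  rcases lt_or_ge z 0 with hz | hz
  · rw [wordCount_of_neg ha hz]
    positivity
  · obtain ⟨m, hm⟩ := exists_nat_gt (z / a i₀)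
    have := key m z (by linarith [ha i₁]) ((div_lt_iff₀ (ha i₀)).1 hm)
    linarith

end WordCount

section NormalizedWordCount

variable {n : ℕ} {a : Fin n → ℝ}

lemma normalizedWordCount_eq (ha : ∀ i, 0 < a i) {z : ℝ} (hz : 0 ≤ z) :
    wordCount n a z / Real.exp z = Real.exp (-z) +
      ∑ i, Real.exp (-a i) * (wordCount n a (z - a i) / Real.exp (z - a i)) := by
  rw [wordCount_eq_one_add ha hz, add_div, Finset.sum_div, Real.exp_neg, one_div]
  congr 1
  refine Finset.sum_congr rfl fun i _ => ?_
  rw [Real.exp_sub, Real.exp_neg]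
  field_simp

lemma intervalIntegrable_normalizedWordCount (ha : ∀ i, 0 < a i) (x y : ℝ) :
    IntervalIntegrable (fun z => wordCount n a z / Real.exp z) MeasureTheory.volume x y := by
  simp only [div_eq_mul_inv]
  exact (wordCount_mono ha).intervalIntegrable.mul_continuousOn
    (Real.continuous_exp.inv₀ Real.exp_ne_zero).continuousOn

lemma normalizedWordCount_sub_le (ha : ∀ i, 0 < a i) {y y' h : ℝ} (hyy' : y' ≤ y)
    (hy : y ≤ y' + h) :
    wordCount n a y' / Real.exp y' ≤ Real.exp h * (wordCount n a y / Real.exp y) := by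
  have h1 := wordCount_mono ha hyy'
  have h2 : Real.exp y ≤ Real.exp y' * Real.exp h := by
    rw [← Real.exp_add]
    exact Real.exp_le_exp.2 hy
  rw [← mul_div_assoc, div_le_div_iff₀ (Real.exp_pos _) (Real.exp_pos _)]
  have := wordCount_nonneg n a y
  calc wordCount n a y' * Real.exp y ≤ wordCount n a y * (Real.exp y' * Real.exp h) := by gcongr
    _ = _ := by ring

/-- Integrating the renewal equation. -/
lemma sum_mul_integral_normalizedWordCount (ha : ∀ i, 0 < a i)
    (hsum : ∑ i, Real.exp (-a i) = 1) {z : ℝ} (hz : 0 ≤ z) :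
    ∑ i, Real.exp (-a i) * ∫ t in (z - a i)..z, wordCount n a t / Real.exp t =
      1 - Real.exp (-z) := by
  set G : ℝ → ℝ := fun t => wordCount n a t / Real.exp t with hG
  have hint : ∀ x y, IntervalIntegrable G MeasureTheory.volume x y :=
    intervalIntegrable_normalizedWordCount ha
  have hzero : ∀ i, ∫ t in (-a i)..0, G t = 0 := by
    intro i
    rw [intervalIntegral.integral_of_le (by linarith [ha i]),
      MeasureTheory.integral_Ioc_eq_integral_Ioo]
    refine MeasureTheory.setIntegral_eq_zero_of_forall_eq_zero fun t ht => ?_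
    simp [hG, wordCount_of_neg ha ht.2]
  have hshift : ∀ i, ∫ t in (0 : ℝ)..z, G (t - a i) = ∫ t in (0 : ℝ)..(z - a i), G t := by
    intro i
    rw [intervalIntegral.integral_comp_sub_right, zero_sub,
      ← intervalIntegral.integral_add_adjacent_intervals (hint _ 0) (hint 0 _), hzero, zero_add]
  have hshint : ∀ i ∈ Finset.univ, IntervalIntegrable (fun t => Real.exp (-a i) * G (t - a i))
      MeasureTheory.volume 0 z := by
    intro i _
    refine IntervalIntegrable.const_mul ?_ _
    simpa using (hint (0 - a i) (z - a i)).comp_sub_right (a i)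
  have hexp : ∫ t in (0 : ℝ)..z, Real.exp (-t) = 1 - Real.exp (-z) := by
    simp
  have hrenew : ∫ t in (0 : ℝ)..z, G t = 1 - Real.exp (-z) +
      ∑ i, Real.exp (-a i) * ∫ t in (0 : ℝ)..(z - a i), G t := by
    have : ∫ t in (0 : ℝ)..z, G t =
        ∫ t in (0 : ℝ)..z, (Real.exp (-t) + ∑ i, Real.exp (-a i) * G (t - a i)) := by
      refine intervalIntegral.integral_congr fun t ht => ?_
      rw [Set.uIcc_of_le hz] at ht
      exact normalizedWordCount_eq ha ht.1
    have hexpint : IntervalIntegrable (fun t : ℝ => Real.exp (-t)) MeasureTheory.volume 0 z :=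
      (by fun_prop : Continuous fun t : ℝ => Real.exp (-t)).intervalIntegrable _ _
    rw [this, intervalIntegral.integral_add hexpint
      (by simpa only [Finset.sum_fn] using IntervalIntegrable.sum _ hshint), hexp,
      intervalIntegral.integral_finsetSum hshint]
    simp only [intervalIntegral.integral_const_mul, hshift]
  have hsub : ∀ i, ∫ t in (z - a i)..z, G t =
      (∫ t in (0 : ℝ)..z, G t) - ∫ t in (0 : ℝ)..(z - a i), G t := fun i =>
    (intervalIntegral.integral_interval_sub_left (hint _ _) (hint _ _)).symm
  simp only [hsub, mul_sub, Finset.sum_sub_distrib, ← Finset.sum_mul, hsum]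
  linarith

lemma tendsto_normalizedWordCount_sub (ha : ∀ i, 0 < a i) :
    Tendsto (fun z => wordCount n a z / Real.exp z -
      ∑ i, Real.exp (-a i) * (wordCount n a (z - a i) / Real.exp (z - a i))) atTop (𝓝 0) := by
  refine (Real.tendsto_exp_neg_atTop_nhds_zero).congr' ?_
  filter_upwards [eventually_ge_atTop 0] with z hz
  rw [normalizedWordCount_eq ha hz, add_sub_cancel_right]

lemma limsup_normalizedWordCount_le (ha : ∀ i, 0 < a i) (hsum : ∑ i, Real.exp (-a i) = 1)
    (hirr : ∃ i j, Irrational (a i / a j)) {L : ℝ}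
    (hup : ∀ ε > 0, ∀ᶠ z in atTop, wordCount n a z / Real.exp z < L + ε)
    (hfr : ∀ ε > 0, ∃ᶠ z in atTop, L - ε < wordCount n a z / Real.exp z) :
    L * ∑ i, a i * Real.exp (-a i) ≤ 1 := by
  set H := ∑ i, a i * Real.exp (-a i) with hH
  have key : ∀ ε > 0, (L - ε) * H ≤ Real.exp ε := by
    intro ε hε
    have : Nonempty (Fin n) := ⟨hirr.choose⟩
    obtain ⟨i₁, hmax⟩ := Finite.exists_max a
    obtain ⟨z, hz, hw⟩ := exists_window_near_limsup ha hirr (fun i => Real.exp_pos (-a i)) hsum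
      (tendsto_normalizedWordCount_sub ha) hup hfr hε (a i₁) 0
    have hz' : 0 ≤ z + a i₁ := by linarith [ha i₁]
    have hid := sum_mul_integral_normalizedWordCount ha hsum hz'
    have hle : ∑ i, Real.exp (-a i) * (a i * (Real.exp (-ε) * (L - ε))) ≤
        1 - Real.exp (-(z + a i₁)) := by
      rw [← hid]
      refine Finset.sum_le_sum fun i _ => mul_le_mul_of_nonneg_left ?_ (Real.exp_pos _).le
      have hconst : ∫ _ in (z + a i₁ - a i)..(z + a i₁), Real.exp (-ε) * (L - ε) =
          a i * (Real.exp (-ε) * (L - ε)) := by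
        rw [intervalIntegral.integral_const, sub_sub_cancel, smul_eq_mul]
      rw [← hconst]
      refine intervalIntegral.integral_mono_on (by linarith [ha i]) (by simp)
        (intervalIntegrable_normalizedWordCount ha _ _) fun y hy => ?_
      obtain ⟨y', hy', h⟩ := hw y ⟨by linarith [hy.1, hmax i], hy.2⟩
      have := h.le.trans (normalizedWordCount_sub_le ha (h := ε) hy'.2 (by linarith [hy'.1]))
      rwa [Real.exp_neg, inv_mul_le_iff₀ (Real.exp_pos _)]
    have heq : ∑ i, Real.exp (-a i) * (a i * (Real.exp (-ε) * (L - ε))) =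
        Real.exp (-ε) * ((L - ε) * H) := by
      rw [hH, Finset.mul_sum, Finset.mul_sum]
      exact Finset.sum_congr rfl fun i _ => by ring
    rw [heq, Real.exp_neg, inv_mul_le_iff₀ (Real.exp_pos _)] at hle
    have := mul_pos (Real.exp_pos ε) (Real.exp_pos (-(z + a i₁)))
    linarith
  have hc : Tendsto (fun ε => Real.exp ε - (L - ε) * H) (𝓝[>] 0) (𝓝 (1 - L * H)) := by
    have : Continuous fun ε => Real.exp ε - (L - ε) * H := by fun_prop
    simpa using (this.tendsto 0).mono_left nhdsWithin_le_nhds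
  exact sub_nonneg.1 (ge_of_tendsto hc (by
    filter_upwards [self_mem_nhdsWithin] with ε hε using sub_nonneg.2 (key ε hε)))

lemma le_liminf_normalizedWordCount (ha : ∀ i, 0 < a i) (hsum : ∑ i, Real.exp (-a i) = 1)
    (hirr : ∃ i j, Irrational (a i / a j)) {l : ℝ}
    (hlow : ∀ ε > 0, ∀ᶠ z in atTop, l - ε < wordCount n a z / Real.exp z)
    (hfr : ∀ ε > 0, ∃ᶠ z in atTop, wordCount n a z / Real.exp z < l + ε) :
    1 ≤ l * ∑ i, a i * Real.exp (-a i) := by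
  set H := ∑ i, a i * Real.exp (-a i) with hH
  have key : ∀ ε > 0, 1 - ε ≤ Real.exp ε * (l + ε) * H := by
    intro ε hε
    have : Nonempty (Fin n) := ⟨hirr.choose⟩
    obtain ⟨i₁, hmax⟩ := Finite.exists_max a
    obtain ⟨R, hR⟩ := eventually_atTop.1
      (Real.tendsto_exp_neg_atTop_nhds_zero.eventually_le_const hε)
    obtain ⟨z, hz, hw⟩ := exists_window_near_limsup (L := -l)
      (F := fun z => -(wordCount n a z / Real.exp z)) ha hirr (fun i => Real.exp_pos (-a i)) hsum
      (by simpa [neg_add_eq_sub] using (tendsto_normalizedWordCount_sub ha).neg)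
      (fun δ hδ => (hlow δ hδ).mono fun z hz => by linarith)
      (fun δ hδ => (hfr δ hδ).mono fun z hz => by linarith) hε (a i₁ + ε) (max R 0)
    have hz0 : 0 ≤ z := (le_max_right _ _).trans hz
    have hz' : 0 ≤ z + a i₁ := by linarith [ha i₁]
    have hid := sum_mul_integral_normalizedWordCount ha hsum hz'
    have hsmall := hR (z + a i₁) (by linarith [ha i₁, le_max_left R 0])
    have hle : 1 - Real.exp (-(z + a i₁)) ≤
        ∑ i, Real.exp (-a i) * (a i * (Real.exp ε * (l + ε))) := by
      rw [← hid]
      refine Finset.sum_le_sum fun i _ => mul_le_mul_of_nonneg_left ?_ (Real.exp_pos _).le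
      have hconst : ∫ _ in (z + a i₁ - a i)..(z + a i₁), Real.exp ε * (l + ε) =
          a i * (Real.exp ε * (l + ε)) := by
        rw [intervalIntegral.integral_const, sub_sub_cancel, smul_eq_mul]
      rw [← hconst]
      refine intervalIntegral.integral_mono_on (by linarith [ha i])
        (intervalIntegrable_normalizedWordCount ha _ _) (by simp) fun y hy => ?_
      obtain ⟨y', hy', h⟩ := hw (y + ε) ⟨by linarith [hy.1, hmax i], by linarith [hy.2]⟩
      refine (normalizedWordCount_sub_le ha (h := ε) (by linarith [hy'.1]) hy'.2).trans ?_
      exact mul_le_mul_of_nonneg_left (by linarith) (Real.exp_pos _).le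
    have heq : ∑ i, Real.exp (-a i) * (a i * (Real.exp ε * (l + ε))) =
        Real.exp ε * (l + ε) * H := by
      rw [hH, Finset.mul_sum]
      exact Finset.sum_congr rfl fun i _ => by ring
    linarith
  have hc : Tendsto (fun ε => Real.exp ε * (l + ε) * H - (1 - ε)) (𝓝[>] 0) (𝓝 (l * H - 1)) := by
    have : Continuous fun ε => Real.exp ε * (l + ε) * H - (1 - ε) := by fun_prop
    simpa using (this.tendsto 0).mono_left nhdsWithin_le_nhds
  exact sub_nonneg.1 (ge_of_tendsto hc (by
    filter_upwards [self_mem_nhdsWithin] with ε hε using sub_nonneg.2 (key ε hε)))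

end NormalizedWordCount

/-- Main theorem, multinomial form: `Q(z)/e^z → 1/H(p)` where
`H(p) = ∑ a i e^{-a i}` is the entropy of `p = (e^{-a₁},…,e^{-aₙ})`. -/
theorem wordCount_asymptotics (n : ℕ) (hn : 2 ≤ n) (a : Fin n → ℝ)
    (ha : ∀ i, 0 < a i) (hsum : ∑ i, Real.exp (-a i) = 1)
    (hirr : ∃ i j, Irrational (a i / a j)) :
    Filter.Tendsto (fun z : ℝ => wordCount n a z / Real.exp z)
      Filter.atTop (nhds (1 / ∑ i, a i * Real.exp (-a i))) := by
  have hH : 0 < ∑ i, a i * Real.exp (-a i) :=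
    Finset.sum_pos (fun i _ => mul_pos (ha i) (Real.exp_pos _)) ⟨⟨0, by omega⟩, Finset.mem_univ _⟩
  obtain ⟨C, hC⟩ := wordCount_le_exp hn ha hsum
  have hle : IsBoundedUnder (· ≤ ·) atTop fun z => wordCount n a z / Real.exp z :=
    isBoundedUnder_of ⟨C, fun z => (div_le_iff₀ (Real.exp_pos z)).2 (hC z)⟩
  have hge : IsBoundedUnder (· ≥ ·) atTop fun z => wordCount n a z / Real.exp z :=
    isBoundedUnder_of ⟨0, fun z => div_nonneg (wordCount_nonneg n a z) (Real.exp_pos z).le⟩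
  refine tendsto_of_le_liminf_of_limsup_le ?_ ?_ hle hge
  · rw [div_le_iff₀ hH]
    exact le_liminf_normalizedWordCount ha hsum hirr
      (fun ε hε => eventually_lt_of_lt_liminf (sub_lt_self _ hε) hge)
      fun ε hε => frequently_lt_of_liminf_lt hle.isCoboundedUnder_ge (lt_add_of_pos_right _ hε)
  · rw [le_div_iff₀ hH]
    exact limsup_normalizedWordCount_le ha hsum hirr
      (fun ε hε => eventually_lt_of_limsup_lt (lt_add_of_pos_right _ hε) hle)
      fun ε hε => frequently_lt_of_lt_limsup hge.isCoboundedUnder_le (sub_lt_self _ hε)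
end

section
/- Integral analogue: Let a_1,...,a_n > 0 with ∑_{i=1}^n e^{-a_i} = 1 and p_i = e^{-a_i}. Extend the multinomial coefficient to M(x) = Γ(∑ x_i + 1)/∏ Γ(x_i + 1) for x ∈ ℝ_{≥0}^n and set f(z) = ∫_{S(z)} M(x) dx over the simplex S(z) = {x ≥ 0 : ∑ a_i x_i ≤ z}. Then lim_{z→∞} f(z)/e^z = 1/H(p), where H(p) = -∑ p_i ln p_i. -/
open MeasureTheory

open Filter Topology in
/-- The difference between `log Γ(x + 1)` and its Stirling approximation. -/
noncomputable def logGammaStirlingError (x : ℝ) : ℝ :=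
  Real.log (Real.Gamma (x + 1)) - (Real.log x / 2 + x * Real.log x - x)

open Filter Topology in
lemma tendsto_logGammaStirlingError_nat :
    Tendsto (fun n : ℕ => logGammaStirlingError n) atTop
      (𝓝 (Real.log (2 * Real.pi) / 2)) := by
  have h := (Real.continuousAt_log (Real.sqrt_pos.2 Real.pi_pos).ne').tendsto.comp
    Stirling.tendsto_stirlingSeq_sqrt_pi
  have h2 := h.add_const (Real.log 2 / 2)
  have e : Real.log √Real.pi + Real.log 2 / 2 = Real.log (2 * Real.pi) / 2 := by
    rw [Real.log_sqrt Real.pi_pos.le, Real.log_mul two_ne_zero Real.pi_ne_zero]; ring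
  rw [e] at h2
  refine h2.congr' ?_
  filter_upwards [eventually_gt_atTop 0] with n hn
  have hn' : (n : ℝ) ≠ 0 := by positivity
  simp only [Function.comp_apply, Stirling.log_stirlingSeq_formula, logGammaStirlingError]
  rw [Real.Gamma_nat_eq_factorial, Real.log_mul two_ne_zero hn',
    Real.log_div hn' (Real.exp_pos 1).ne', Real.log_exp]
  ring

lemma log_Gamma_add_one {y : ℝ} (hy : 0 < y) :
    (Real.log ∘ Real.Gamma) (y + 1) = (Real.log ∘ Real.Gamma) y + Real.log y := by
  simp only [Function.comp_apply]
  rw [Real.Gamma_add_one hy.ne', Real.log_mul hy.ne' (Real.Gamma_pos_of_pos hy).ne', add_comm]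

lemma abs_logGammaStirlingError_add_sub_le {N : ℕ} (hN : 1 ≤ N) {θ : ℝ} (h0 : 0 ≤ θ)
    (h1 : θ ≤ 1) :
    |logGammaStirlingError (N + θ) - logGammaStirlingError N| ≤ 3 / N := by
  have hN0 : (0 : ℝ) < N := by positivity
  rcases h0.eq_or_lt with rfl | hθ
  · simp only [add_zero, sub_self, abs_zero]; positivity
  have hx : 0 < (N : ℝ) + θ := by positivity
  have hup := Real.BohrMollerup.f_add_nat_le (n := N + 1) Real.convexOn_log_Gamma
    log_Gamma_add_one (by lia) hθ h1
  have hlo := Real.BohrMollerup.f_add_nat_ge (n := N + 1) Real.convexOn_log_Gamma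
    log_Gamma_add_one (by lia) hθ
  push_cast at hup hlo
  simp only [Function.comp_apply, add_sub_cancel_right] at hup hlo
  have e1 : (N : ℝ) + 1 + θ = N + θ + 1 := by ring
  rw [e1] at hup hlo
  have l1 : Real.log (N + 1) ≤ Real.log N + 1 / N := by
    have := Real.log_le_sub_one_of_pos (x := ((N : ℝ) + 1) / N) (by positivity)
    rw [Real.log_div (by positivity) hN0.ne'] at this
    have e : ((N : ℝ) + 1) / N - 1 = 1 / N := by field_simp; ring
    linarith
  have l2 : Real.log (N + θ) ≤ Real.log N + θ / N := by
    have := Real.log_le_sub_one_of_pos (x := ((N : ℝ) + θ) / N) (by positivity)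
    rw [Real.log_div (by positivity) hN0.ne'] at this
    have e : ((N : ℝ) + θ) / N - 1 = θ / N := by field_simp; ring
    linarith
  have l3 : Real.log N + θ / (N + θ) ≤ Real.log (N + θ) := by
    have := Real.log_le_sub_one_of_pos (x := (N : ℝ) / (N + θ)) (by positivity)
    rw [Real.log_div hN0.ne' hx.ne'] at this
    have e : (N : ℝ) / (N + θ) - 1 = - (θ / (N + θ)) := by field_simp; ring
    linarith
  have m1 : θ * Real.log (N + 1) ≤ θ * Real.log N + 1 / N := by
    have : θ * (1 / N) ≤ 1 / N := mul_le_of_le_one_left (by positivity) h1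
    nlinarith
  have m2 : (N + θ) * Real.log (N + θ) ≤ (N + θ) * Real.log N + θ + 1 / N := by
    have := mul_le_mul_of_nonneg_left l2 hx.le
    have e : ((N : ℝ) + θ) * (Real.log N + θ / N) = (N + θ) * Real.log N + θ + θ * θ / N := by
      field_simp; ring
    have : θ * θ / N ≤ 1 / N := by gcongr; nlinarith
    linarith
  have m3 : (N + θ) * Real.log N + θ ≤ (N + θ) * Real.log (N + θ) := by
    have := mul_le_mul_of_nonneg_left l3 hx.le
    have e : ((N : ℝ) + θ) * (Real.log N + θ / (N + θ)) = (N + θ) * Real.log N + θ := by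
      field_simp
    linarith
  have l2' : Real.log (N + θ) ≤ Real.log N + 1 / N := l2.trans (by gcongr)
  have l3' : Real.log N ≤ Real.log (N + θ) := Real.log_le_log hN0 (by linarith)
  have e3 : (3 : ℝ) / N = 3 * (1 / N) := by ring
  have hp : 0 < 1 / (N : ℝ) := by positivity
  simp only [logGammaStirlingError]
  rw [abs_le, e3]
  constructor <;> linarith

open Filter Topology in
lemma tendsto_logGammaStirlingError :
    Tendsto logGammaStirlingError atTop (𝓝 (Real.log (2 * Real.pi) / 2)) := by
  have hfl : Tendsto (fun x : ℝ => ⌊x⌋₊) atTop atTop := tendsto_nat_floor_atTop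
  have h1 := tendsto_logGammaStirlingError_nat.comp hfl
  have h2 : Tendsto (fun x : ℝ => (3 : ℝ) / ⌊x⌋₊) atTop (𝓝 0) :=
    (tendsto_const_nhds.div_atTop tendsto_natCast_atTop_atTop).comp hfl
  have h3 : Tendsto (fun x : ℝ => logGammaStirlingError x - logGammaStirlingError ⌊x⌋₊)
      atTop (𝓝 0) := by
    refine squeeze_zero_norm' ?_ h2
    filter_upwards [eventually_ge_atTop 1] with x hx
    have := abs_logGammaStirlingError_add_sub_le (N := ⌊x⌋₊) (Nat.le_floor (by simpa using hx))
      (θ := x - ⌊x⌋₊) (sub_nonneg.2 (Nat.floor_le (by linarith)))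
      (by have := Nat.lt_floor_add_one x; linarith)
    simpa using this
  simpa using h3.add h1

open Filter Topology in
lemma tendsto_Gamma_add_one_div_stirling :
    Tendsto (fun x : ℝ => Real.Gamma (x + 1) / (√(x + 1) * Real.exp (x * Real.log x - x)))
      atTop (𝓝 √(2 * Real.pi)) := by
  have h1 : Tendsto (fun x : ℝ => Real.log ((x + 1) / x)) atTop (𝓝 0) := by
    have : Tendsto (fun x : ℝ => 1 + 1 / x) atTop (𝓝 (1 + 0)) :=
      tendsto_const_nhds.add (tendsto_const_nhds.div_atTop tendsto_id)
    rw [add_zero] at this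
    have := (Real.continuousAt_log one_ne_zero).tendsto.comp this
    rw [Real.log_one] at this
    refine this.congr' ?_
    filter_upwards [eventually_gt_atTop 0] with x hx
    simp only [Function.comp_apply]
    congr 1
    field_simp
  have h2 := (Real.continuous_exp.tendsto _).comp
    (tendsto_logGammaStirlingError.sub (h1.div_const 2))
  have e : Real.exp (Real.log (2 * Real.pi) / 2 - 0 / 2) = √(2 * Real.pi) := by
    rw [zero_div, sub_zero, ← Real.log_sqrt (by positivity), Real.exp_log (by positivity)]
  rw [e] at h2
  refine h2.congr' ?_
  filter_upwards [eventually_gt_atTop 0] with x hx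
  have hG : 0 < Real.Gamma (x + 1) := Real.Gamma_pos_of_pos (by linarith)
  rw [Function.comp_apply, ← Real.exp_log (x := Real.Gamma (x + 1) / _) (by positivity),
    Real.log_div hG.ne' (by positivity), Real.log_mul (by positivity) (by positivity),
    Real.log_exp, Real.log_sqrt (by positivity), Real.log_div (by positivity) hx.ne',
    logGammaStirlingError]
  congr 1
  ring

open Filter Topology in
lemma exists_stirling_le_Gamma_add_one :
    ∃ c > 0, ∀ x : ℝ, 0 ≤ x →
      c * (√(x + 1) * Real.exp (x * Real.log x - x)) ≤ Real.Gamma (x + 1) := by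
  obtain ⟨N, hN⟩ := eventually_atTop.1
    (tendsto_Gamma_add_one_div_stirling.eventually_const_le (half_lt_self (by positivity)))
  have hcont : ContinuousOn
      (fun x : ℝ => Real.Gamma (x + 1) / (√(x + 1) * Real.exp (x * Real.log x - x)))
      (Set.Icc 0 (max N 0)) := by
    refine ContinuousOn.div ?_ ?_ ?_
    · intro x hx
      have hx0 : 0 < x + 1 := by linarith [hx.1]
      have hd : ContinuousAt Real.Gamma ((fun x : ℝ => x + 1) x) := by
        refine (Real.differentiableAt_Gamma fun m => ?_).continuousAt
        have : (0 : ℝ) ≤ m := by positivity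
        exact ne_of_gt (by linarith)
      exact (ContinuousAt.comp (g := Real.Gamma) (f := fun x : ℝ => x + 1) hd (by fun_prop)).continuousWithinAt
    · have := Real.continuous_mul_log
      fun_prop
    · intro x hx
      have hx0 : 0 < x + 1 := by linarith [hx.1]
      positivity
  obtain ⟨x₀, hx₀, hmin⟩ := isCompact_Icc.exists_isMinOn
    (Set.nonempty_Icc.2 (le_max_right N 0)) hcont
  have hx₀' : 0 < x₀ + 1 := by linarith [hx₀.1]
  have hG : 0 < Real.Gamma (x₀ + 1) := Real.Gamma_pos_of_pos hx₀'
  refine ⟨min (√(2 * Real.pi) / 2)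
    (Real.Gamma (x₀ + 1) / (√(x₀ + 1) * Real.exp (x₀ * Real.log x₀ - x₀))),
    lt_min (by positivity) (by positivity), fun x hx => ?_⟩
  have hx' : 0 < x + 1 := by linarith
  rw [← le_div_iff₀ (by positivity)]
  rcases le_total N x with h | h
  · exact (min_le_left _ _).trans (hN x h)
  · exact (min_le_right _ _).trans (hmin ⟨hx, h.trans (le_max_left _ _)⟩)

lemma measurable_Gamma_real : Measurable Real.Gamma := by
  have h : Real.Gamma = fun x : ℝ => (((Complex.Gamma x)⁻¹).re)⁻¹ := by
    funext x
    rw [Complex.Gamma_ofReal, ← Complex.ofReal_inv, Complex.ofReal_re, inv_inv]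
  rw [h]
  refine Measurable.inv (Continuous.measurable ?_)
  exact Complex.continuous_re.comp
    (Complex.differentiable_one_div_Gamma.continuous.comp Complex.continuous_ofReal)

/-- The Poisson weight `e^{-m} m^x / Γ(x + 1)` at a real argument `x ≥ 0`, extended by zero. -/
noncomputable def poissonWeight (m x : ℝ) : ℝ :=
  if 0 ≤ x then Real.exp (-m) * m ^ x / Real.Gamma (x + 1) else 0

/-- The real Poisson weight of mean `p (t - 1)`, recentred and rescaled by `√t`. -/
noncomputable def rescaledPoisson (p t y : ℝ) : ℝ :=
  √t * poissonWeight (p * (t - 1)) (p * (t - 1) + √t * y)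

/-- The centred Gaussian density of variance `p`. -/
noncomputable def gaussianDensity (p y : ℝ) : ℝ :=
  (√(2 * Real.pi * p))⁻¹ * Real.exp (-(1 / (2 * p)) * y ^ 2)

lemma poissonWeight_nonneg {m : ℝ} (hm : 0 ≤ m) (x : ℝ) : 0 ≤ poissonWeight m x := by
  unfold poissonWeight
  split_ifs with hx
  · have := Real.Gamma_pos_of_pos (s := x + 1) (by linarith)
    positivity
  · exact le_rfl

lemma poissonWeight_of_neg (m : ℝ) {x : ℝ} (hx : x < 0) : poissonWeight m x = 0 :=
  if_neg (not_le.2 hx)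

lemma measurable_poissonWeight : Measurable fun q : ℝ × ℝ => poissonWeight q.1 q.2 := by
  unfold poissonWeight
  refine Measurable.ite (measurableSet_le measurable_const measurable_snd) ?_ measurable_const
  refine Measurable.div ?_ (measurable_Gamma_real.comp (by fun_prop))
  exact Measurable.mul (by fun_prop) (measurable_fst.pow measurable_snd)

lemma rescaledPoisson_nonneg {p t : ℝ} (hp : 0 ≤ p) (ht : 1 ≤ t) (y : ℝ) :
    0 ≤ rescaledPoisson p t y :=
  mul_nonneg (Real.sqrt_nonneg _) (poissonWeight_nonneg (mul_nonneg hp (by linarith)) _)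

lemma poissonWeight_eq {m x : ℝ} (hm : 0 < m) (hx : 0 ≤ x) :
    poissonWeight m x = (√(x + 1))⁻¹ *
      (Real.Gamma (x + 1) / (√(x + 1) * Real.exp (x * Real.log x - x)))⁻¹ *
      Real.exp (-(x * Real.log x - x + m - x * Real.log m)) := by
  have h1 : 0 < x + 1 := by linarith
  have hG := Real.Gamma_pos_of_pos h1
  have e : Real.exp (-(x * Real.log x - x + m - x * Real.log m)) =
      Real.exp (-m) * m ^ x / Real.exp (x * Real.log x - x) := by
    rw [Real.rpow_def_of_pos hm, ← Real.exp_add, ← Real.exp_sub]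
    congr 1
    ring
  rw [e, poissonWeight, if_pos hx]
  have h2 : √(x + 1) ≠ 0 := by positivity
  field_simp

lemma chernoff_le_relative_entropy {m x : ℝ} (hm : 0 < m) (hx : 0 ≤ x) (l : ℝ) :
    l * x - m * (Real.exp l - 1) ≤ x * Real.log x - x + m - x * Real.log m := by
  rcases hx.eq_or_lt with rfl | hx
  · have := mul_pos hm (Real.exp_pos l)
    simp only [mul_zero, zero_mul]
    linarith
  · have h := Real.log_le_sub_one_of_pos (x := m * Real.exp l / x) (by positivity)
    rw [Real.log_div (by positivity) hx.ne', Real.log_mul hm.ne' (by positivity),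
      Real.log_exp] at h
    have h2 := mul_le_mul_of_nonneg_left h hx.le
    have e : x * (m * Real.exp l / x - 1) = m * Real.exp l - x := by field_simp
    linarith

lemma sqrt_mul_le_of_eq_add {p t x y : ℝ} (hp : 0 < p) (hp1 : p ≤ 1) (ht : 1 < t) (hx : 0 ≤ x)
    (hxy : x = p * (t - 1) + √t * y) :
    √t ≤ 2 / p * Real.exp (|y| / 2) * √(x + 1) := by
  have hsp : 0 < √p := Real.sqrt_pos.2 hp
  have hsp2 : √p * √p = p := Real.mul_self_sqrt hp.le
  have hst : √t * √t = t := Real.mul_self_sqrt (by linarith)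
  have ht0 : 0 ≤ √t := Real.sqrt_nonneg _
  have hX2 : √(x + 1) * √(x + 1) = x + 1 := Real.mul_self_sqrt (by linarith)
  have hX : 1 ≤ √(x + 1) := Real.one_le_sqrt.2 (by linarith)
  have hsp1 : √p ≤ 1 := Real.sqrt_le_one.2 hp1
  have hb : (|y| / √p) * √p = |y| := by field_simp
  have hb0 : 0 ≤ |y| / √p := by positivity
  have hy : 1 + |y| / 2 ≤ Real.exp (|y| / 2) := by
    have := Real.add_one_le_exp (|y| / 2); linarith
  have key : √p * √t ≤ (1 + |y| / √p) * √(x + 1) := by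
    by_contra! hcon
    set A := √p * √t
    set X := √(x + 1)
    set b := |y| / √p
    have hA : A * A = p * t := by
      calc A * A = (√p * √p) * (√t * √t) := by ring
        _ = p * t := by rw [hsp2, hst]
    have hle : A * A ≤ X * X + A * b := by
      have e : A * b = √t * |y| := by rw [← hb]; ring
      have : -(√t * |y|) ≤ √t * y := by
        have := mul_le_mul_of_nonneg_left (neg_abs_le y) ht0
        linarith
      rw [hA, hX2, e, hxy]
      linarith
    have hA0 : 0 ≤ A := by positivity
    have h1 : A * b ≤ A * b * X := le_mul_of_one_le_right (by positivity) hX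
    have h2 : X < A - b * X := by linarith
    have h3 : X * X < A * (A - b * X) := by
      have : X ≤ A := by nlinarith
      nlinarith
    nlinarith
  have h4 : (1 + |y| / √p) ≤ 2 / √p * Real.exp (|y| / 2) := by
    rw [div_mul_eq_mul_div, le_div_iff₀ hsp, add_mul, hb]
    linarith
  have h5 : √p * √t ≤ 2 / √p * Real.exp (|y| / 2) * √(x + 1) :=
    key.trans (mul_le_mul_of_nonneg_right h4 (by linarith))
  have h6 : √t = √p * √t / √p := by field_simp
  rw [h6, div_le_iff₀ hsp]
  have h7 : 2 / √p = 2 / p * √p := by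
    rw [div_mul_eq_mul_div, div_eq_div_iff hsp.ne' hp.ne']
    linear_combination (-2) * hsp2
  refine h5.trans (le_of_eq ?_)
  rw [h7]
  ring

lemma exists_rescaledPoisson_le {p : ℝ} (hp : 0 < p) (hp1 : p ≤ 1) :
    ∃ C > 0, ∀ t y : ℝ, 1 < t → rescaledPoisson p t y ≤ C * Real.exp (-(|y| / 2)) := by
  obtain ⟨c, hc, hG⟩ := exists_stirling_le_Gamma_add_one
  refine ⟨2 / p * c⁻¹ * Real.exp p, by positivity, fun t y ht => ?_⟩
  unfold rescaledPoisson
  obtain ⟨x, hxy⟩ : ∃ x, x = p * (t - 1) + √t * y := ⟨_, rfl⟩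
  rw [← hxy]
  rcases lt_or_ge x 0 with hx | hx
  · rw [poissonWeight_of_neg _ hx, mul_zero]
    positivity
  have hm : 0 < p * (t - 1) := mul_pos hp (by linarith)
  have hx1 : 0 < x + 1 := by linarith
  have hst : √t * √t = t := Real.mul_self_sqrt (by linarith)
  have hst1 : 1 ≤ √t := Real.one_le_sqrt.2 ht.le
  have hD : |y| - p ≤ x * Real.log x - x + p * (t - 1) - x * Real.log (p * (t - 1)) := by
    have hD' : ∀ s : ℝ, |s| = 1 →
        s * y - p ≤ x * Real.log x - x + p * (t - 1) - x * Real.log (p * (t - 1)) := by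
      intro s hs
      refine le_trans ?_ (chernoff_le_relative_entropy hm hx (s / √t))
      have hs2 : s ^ 2 = 1 := by rw [← sq_abs, hs, one_pow]
      have hl : |s / √t| ≤ 1 := by
        rw [abs_div, hs, abs_of_pos (by positivity)]
        exact (div_le_one (by positivity)).2 hst1
      have he := (abs_le.1 (Real.abs_exp_sub_one_sub_id_le hl)).2
      have he2 : (s / √t) ^ 2 = 1 / t := by rw [div_pow, hs2, sq, hst]
      have he3 : Real.exp (s / √t) - 1 ≤ s / √t + 1 / t := by linarith
      have he4 := mul_le_mul_of_nonneg_left he3 hm.le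
      have he5 : p * (t - 1) * (1 / t) ≤ p := by
        rw [mul_one_div, div_le_iff₀ (by linarith)]
        nlinarith
      have he6 : s / √t * x = s / √t * (p * (t - 1)) + s * y := by
        rw [hxy]; field_simp
      linarith
    rcases abs_cases y with ⟨h, -⟩ | ⟨h, -⟩
    · have := hD' 1 (by simp)
      rwa [one_mul, ← h] at this
    · have := hD' (-1) (by simp)
      rwa [neg_one_mul, ← h] at this
  rw [poissonWeight_eq hm hx]
  have h1 := sqrt_mul_le_of_eq_add hp hp1 ht hx hxy
  have h2 : √t * (√(x + 1))⁻¹ ≤ 2 / p * Real.exp (|y| / 2) := by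
    rw [← div_eq_mul_inv, div_le_iff₀ (by positivity)]
    exact h1
  have h3 : (Real.Gamma (x + 1) / (√(x + 1) * Real.exp (x * Real.log x - x)))⁻¹ ≤ c⁻¹ := by
    refine inv_anti₀ hc ?_
    rw [le_div_iff₀ (by positivity)]
    exact hG x hx
  have h4 : Real.exp (-(x * Real.log x - x + p * (t - 1) - x * Real.log (p * (t - 1)))) ≤
      Real.exp p * Real.exp (-|y|) := by
    rw [← Real.exp_add]
    exact Real.exp_le_exp.2 (by linarith)
  have hGp := Real.Gamma_pos_of_pos hx1
  calc _ = √t * (√(x + 1))⁻¹ *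
        (Real.Gamma (x + 1) / (√(x + 1) * Real.exp (x * Real.log x - x)))⁻¹ *
        Real.exp (-(x * Real.log x - x + p * (t - 1) - x * Real.log (p * (t - 1)))) := by ring
    _ ≤ 2 / p * Real.exp (|y| / 2) * c⁻¹ * (Real.exp p * Real.exp (-|y|)) := by gcongr
    _ = 2 / p * c⁻¹ * Real.exp p * (Real.exp (|y| / 2) * Real.exp (-|y|)) := by ring
    _ = _ := by
      rw [← Real.exp_add]
      congr 2
      ring

lemma abs_mul_log_sub_le {v : ℝ} (hv : |v| ≤ 1 / 2) :
    |((1 + v) * Real.log (1 + v) - v) - v ^ 2 / 2| ≤ 5 * |v| ^ 3 := by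
  have h := Real.abs_log_sub_add_sum_range_le (x := -v) (by rw [abs_neg]; linarith) 2
  rw [abs_neg, sub_neg_eq_add] at h
  norm_num [Finset.sum_range_succ] at h
  have h2 : |v| ^ 3 / (1 - |v|) ≤ 2 * |v| ^ 3 := by
    rw [div_le_iff₀ (by linarith)]
    have : 0 ≤ |v| ^ 3 := by positivity
    nlinarith
  have h3 := h.trans h2
  set r := -v + v ^ 2 / 2 + Real.log (1 + v) with hr
  have e : ((1 + v) * Real.log (1 + v) - v) - v ^ 2 / 2 = -(v ^ 3 / 2) + (1 + v) * r := by
    rw [hr]; ring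
  rw [e]
  have h4 : |1 + v| ≤ 2 := by rw [abs_le] at hv ⊢; constructor <;> linarith [hv.1, hv.2]
  calc _ ≤ |(-(v ^ 3 / 2))| + |(1 + v) * r| := abs_add_le _ _
    _ = |v| ^ 3 / 2 + |1 + v| * |r| := by rw [abs_neg, abs_div, abs_pow, abs_mul]; norm_num
    _ ≤ |v| ^ 3 / 2 + 2 * (2 * |v| ^ 3) := by gcongr
    _ ≤ _ := by have : 0 ≤ |v| ^ 3 := by positivity
                linarith

open Filter Topology in
lemma tendsto_rescaledPoisson {p : ℝ} (hp : 0 < p) (y : ℝ) :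
    Tendsto (fun t => rescaledPoisson p t y) atTop (𝓝 (gaussianDensity p y)) := by
  set m : ℝ → ℝ := fun t => p * (t - 1) with hm
  set x : ℝ → ℝ := fun t => p * (t - 1) + √t * y with hx
  have hinv : Tendsto (fun t : ℝ => 1 / t) atTop (𝓝 0) :=
    tendsto_const_nhds.div_atTop tendsto_id
  have hsinv : Tendsto (fun t : ℝ => 1 / √t) atTop (𝓝 0) :=
    tendsto_const_nhds.div_atTop Real.tendsto_sqrt_atTop
  have hmt : Tendsto (fun t => m t / t) atTop (𝓝 p) := by
    have : Tendsto (fun t : ℝ => p * (1 - 1 / t)) atTop (𝓝 (p * (1 - 0))) :=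
      (tendsto_const_nhds.sub hinv).const_mul p
    rw [sub_zero, mul_one] at this
    refine this.congr' ?_
    filter_upwards [eventually_gt_atTop 0] with t ht
    simp only [hm]
    field_simp
  have hxt : Tendsto (fun t => x t / t) atTop (𝓝 p) := by
    have : Tendsto (fun t : ℝ => m t / t + y * (1 / √t)) atTop (𝓝 (p + y * 0)) :=
      hmt.add (hsinv.const_mul y)
    rw [mul_zero, add_zero] at this
    refine this.congr' ?_
    filter_upwards [eventually_gt_atTop 0] with t ht
    have hst : √t * √t = t := Real.mul_self_sqrt ht.le
    have hs : 0 < √t := Real.sqrt_pos.2 ht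
    simp only [hm, hx]
    rw [add_div]
    congr 1
    field_simp
    rw [sq, hst]
  have hxtop : Tendsto x atTop atTop := by
    have := hxt.pos_mul_atTop hp tendsto_id
    refine this.congr' ?_
    filter_upwards [eventually_gt_atTop 0] with t ht
    simp only [id]
    field_simp
  have h1 : Tendsto (fun t => √t * (√(x t + 1))⁻¹) atTop (𝓝 (√p)⁻¹) := by
    have a1 : Tendsto (fun t => √(x t / t + 1 / t)) atTop (𝓝 √(p + 0)) :=
      (hxt.add hinv).sqrt
    rw [add_zero] at a1
    have a2 := a1.inv₀ (Real.sqrt_pos.2 hp).ne'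
    refine a2.congr' ?_
    filter_upwards [eventually_gt_atTop 0, hxtop.eventually_ge_atTop 0] with t ht hxt0
    rw [← add_div, Real.sqrt_div (by linarith), inv_div, div_eq_mul_inv]
  have h2 := (tendsto_Gamma_add_one_div_stirling.comp hxtop).inv₀ (by positivity)
  set v : ℝ → ℝ := fun t => √t * y / m t with hv
  have hv2 : Tendsto (fun t => m t * v t ^ 2) atTop (𝓝 (y ^ 2 / p)) := by
    have := (tendsto_const_nhds (x := y ^ 2)).div hmt hp.ne'
    refine this.congr' ?_
    filter_upwards [eventually_gt_atTop 1] with t ht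
    have hmp : 0 < m t := mul_pos hp (by linarith)
    have hst : √t ^ 2 = t := Real.sq_sqrt (by linarith)
    simp only [hv, Pi.div_apply]
    rw [div_pow, mul_pow, hst]
    field_simp
  have hv0 : Tendsto v atTop (𝓝 0) := by
    have : Tendsto (fun t : ℝ => y * (1 / √t) / (m t / t)) atTop (𝓝 (y * 0 / p)) :=
      (hsinv.const_mul y).div hmt hp.ne'
    rw [mul_zero, zero_div] at this
    refine this.congr' ?_
    filter_upwards [eventually_gt_atTop 1] with t ht
    have hmp : 0 < m t := mul_pos hp (by linarith)
    have hs : 0 < √t := Real.sqrt_pos.2 (by linarith)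
    have hst : √t * √t = t := Real.mul_self_sqrt (by linarith)
    simp only [hv]
    rw [div_div_eq_mul_div, mul_one_div]
    congr 1
    rw [div_mul_eq_mul_div, div_eq_iff hs.ne']
    linear_combination (-y) * hst
  have h3 : Tendsto (fun t => x t * Real.log (x t) - x t + m t - x t * Real.log (m t)) atTop
      (𝓝 (y ^ 2 / p / 2)) := by
    have b1 : Tendsto (fun t => m t * (((1 + v t) * Real.log (1 + v t) - v t) - v t ^ 2 / 2))
        atTop (𝓝 0) := by
      have b2 : Tendsto (fun t => 5 * (m t * v t ^ 2) * |v t|) atTop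
          (𝓝 (5 * (y ^ 2 / p) * |(0 : ℝ)|)) := (hv2.const_mul 5).mul hv0.abs
      rw [abs_zero, mul_zero] at b2
      refine squeeze_zero_norm' ?_ b2
      have hv0' : Tendsto (fun t => |v t|) atTop (𝓝 0) := by simpa using hv0.abs
      filter_upwards [eventually_gt_atTop 1,
        hv0'.eventually_le_const (show (0 : ℝ) < 1 / 2 by norm_num)] with t ht hvt
      have hmp : 0 < m t := mul_pos hp (by linarith)
      rw [Real.norm_eq_abs, abs_mul, abs_of_pos hmp]
      have := mul_le_mul_of_nonneg_left (abs_mul_log_sub_le hvt) hmp.le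
      refine this.trans (le_of_eq ?_)
      rw [← sq_abs (v t)]
      ring
    have b3 := b1.add (hv2.div_const 2)
    rw [zero_add] at b3
    refine b3.congr' ?_
    filter_upwards [eventually_gt_atTop 1, hxtop.eventually_gt_atTop 0] with t ht hxt0
    have hmp : 0 < m t := mul_pos hp (by linarith)
    have hxm : x t = m t * (1 + v t) := by
      simp only [hx, hv, hm] at hmp ⊢
      have : t - 1 ≠ 0 := by linarith
      field_simp
    have h1v : 0 < 1 + v t := by
      rw [hxm] at hxt0
      exact (pos_iff_pos_of_mul_pos hxt0).1 hmp
    rw [hxm, Real.log_mul hmp.ne' h1v.ne']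
    ring
  have h4 := (Real.continuous_exp.tendsto _).comp h3.neg
  have h5 := (h1.mul h2).mul h4
  have e : gaussianDensity p y =
      (√p)⁻¹ * (√(2 * Real.pi))⁻¹ * Real.exp (-(y ^ 2 / p / 2)) := by
    rw [gaussianDensity, Real.sqrt_mul (by positivity) p, mul_inv, mul_comm (√p)⁻¹]
    congr 2
    field_simp
  rw [e]
  refine h5.congr' ?_
  filter_upwards [eventually_gt_atTop 1, hxtop.eventually_ge_atTop 0] with t ht hxt0
  rw [rescaledPoisson, poissonWeight_eq (mul_pos hp (by linarith)) hxt0]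
  simp only [Function.comp_apply, hx, hm]
  ring

lemma integral_gaussianDensity {p : ℝ} (hp : 0 < p) : ∫ y, gaussianDensity p y = 1 := by
  unfold gaussianDensity
  rw [integral_const_mul, integral_gaussian]
  have : Real.pi / (1 / (2 * p)) = 2 * Real.pi * p := by field_simp
  rw [this, inv_mul_cancel₀]
  positivity

lemma integrable_gaussianDensity {p : ℝ} (hp : 0 < p) : Integrable (gaussianDensity p) :=
  (integrable_exp_neg_mul_sq (b := 1 / (2 * p)) (by positivity)).const_mul _

lemma gaussianDensity_nonneg (p y : ℝ) : 0 ≤ gaussianDensity p y := by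
  unfold gaussianDensity; positivity

/-- The kernel `e^{-w}` on `w ≥ 0`, extended by zero. -/
noncomputable def expStep (w : ℝ) : ℝ := if 0 ≤ w then Real.exp (-w) else 0

lemma expStep_nonneg (w : ℝ) : 0 ≤ expStep w := by
  unfold expStep; split_ifs <;> positivity

lemma expStep_le_one (w : ℝ) : expStep w ≤ 1 := by
  unfold expStep
  split_ifs with h
  · exact Real.exp_le_one_iff.2 (by linarith)
  · exact zero_le_one

lemma expStep_of_neg {w : ℝ} (hw : w < 0) : expStep w = 0 := if_neg (not_le.2 hw)

lemma measurable_expStep : Measurable expStep :=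
  Measurable.ite measurableSet_Ici (by fun_prop) measurable_const

lemma continuousAt_expStep {w : ℝ} (hw : w ≠ 0) : ContinuousAt expStep w := by
  rcases lt_or_gt_of_ne hw with h | h
  · refine (continuousAt_const (y := (0 : ℝ))).congr ?_
    filter_upwards [Iio_mem_nhds h] with x hx
    exact (expStep_of_neg hx).symm
  · refine ContinuousAt.congr (f := fun x => Real.exp (-x)) (by fun_prop) ?_
    filter_upwards [Ioi_mem_nhds h] with x hx
    exact (if_pos (le_of_lt hx)).symm

lemma lintegral_expStep_mul {b : ℝ} (hb : 0 < b) {L : ℝ} (hL : 0 ≤ L) :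
    ∫⁻ r, ENNReal.ofReal (expStep (b * r) * L) = ENNReal.ofReal (L / b) := by
  have e : (fun r => ENNReal.ofReal (expStep (b * r) * L)) =
      (Set.Ici (0 : ℝ)).indicator fun r => ENNReal.ofReal (Real.exp (-b * r) * L) := by
    funext r
    by_cases hr : 0 ≤ r
    · rw [Set.indicator_of_mem (Set.mem_Ici.2 hr), expStep, if_pos (by positivity), neg_mul]
    · rw [Set.indicator_of_notMem (by simpa using hr),
        expStep_of_neg (mul_neg_of_pos_of_neg hb (not_le.1 hr)), zero_mul, ENNReal.ofReal_zero]
  have hint : IntegrableOn (fun r => Real.exp (-b * r) * L) (Set.Ioi 0) :=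
    (integrableOn_exp_mul_Ioi (neg_neg_of_pos hb) 0).mul_const L
  rw [e, lintegral_indicator measurableSet_Ici, setLIntegral_congr Ioi_ae_eq_Ici.symm,
    ← ofReal_integral_eq_lintegral_ofReal hint
      (Filter.Eventually.of_forall fun r => by positivity),
    integral_mul_const, integral_exp_mul_Ioi (neg_neg_of_pos hb)]
  congr 1
  simp
  field_simp

/-- The nonnegative root `V` of `H V² + B V = z`. -/
noncomputable def quadraticRoot (H B z : ℝ) : ℝ := (-B + √(B ^ 2 + 4 * H * z)) / (2 * H)

section QuadraticRoot

variable {H z : ℝ}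

lemma quadraticRoot_spec (hH : 0 < H) (hz : 0 ≤ z) (B : ℝ) :
    H * quadraticRoot H B z ^ 2 + B * quadraticRoot H B z = z := by
  have h : √(B ^ 2 + 4 * H * z) ^ 2 = B ^ 2 + 4 * H * z := Real.sq_sqrt (by positivity)
  unfold quadraticRoot
  generalize √(B ^ 2 + 4 * H * z) = S at h ⊢
  field_simp
  linear_combination h

lemma abs_le_sqrt_discriminant (hH : 0 < H) (hz : 0 ≤ z) (B : ℝ) :
    |B| ≤ √(B ^ 2 + 4 * H * z) := by
  apply Real.abs_le_sqrt
  have : 0 ≤ H * z := by positivity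
  linarith

lemma quadraticRoot_nonneg (hH : 0 < H) (hz : 0 ≤ z) (B : ℝ) : 0 ≤ quadraticRoot H B z := by
  have := abs_le_sqrt_discriminant hH hz B
  have := le_abs_self B
  exact div_nonneg (by linarith) (by positivity)

lemma mul_quadraticRoot_add_nonneg (hH : 0 < H) (hz : 0 ≤ z) (B : ℝ) :
    0 ≤ H * quadraticRoot H B z + B := by
  have := abs_le_sqrt_discriminant hH hz B
  have := neg_abs_le B
  have e : H * quadraticRoot H B z + B = (B + √(B ^ 2 + 4 * H * z)) / 2 := by
    unfold quadraticRoot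
    field_simp
    ring
  rw [e]
  linarith

lemma sub_eq_of_quadraticRoot (hH : 0 < H) (hz : 0 ≤ z) (B : ℝ) {t : ℝ} (ht : 0 ≤ t) :
    z - (H * t + B * √t) =
      (quadraticRoot H B z - √t) * (H * (quadraticRoot H B z + √t) + B) := by
  have h := quadraticRoot_spec hH hz B
  have hs : √t ^ 2 = t := Real.sq_sqrt ht
  linear_combination (-1) * h + H * hs

open Filter in
lemma tendsto_quadraticRoot (hH : 0 < H) (B : ℝ) : Tendsto (quadraticRoot H B) atTop atTop := by
  unfold quadraticRoot
  refine Tendsto.atTop_div_const (by positivity) (tendsto_atTop_add_const_left _ _ ?_)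
  refine Real.tendsto_sqrt_atTop.comp (tendsto_atTop_add_const_left _ _ ?_)
  exact tendsto_id.const_mul_atTop (by positivity)

lemma expStep_le_of_two_mul_abs_le (hH : 0 < H) (hz : 0 ≤ z) {B : ℝ}
    (hV : 2 * |B| ≤ H * quadraticRoot H B z) {t : ℝ} (ht : 0 < t) :
    expStep (z - (H * t + B * √t)) ≤ expStep (H / 2 * (quadraticRoot H B z ^ 2 - t)) := by
  rw [sub_eq_of_quadraticRoot hH hz B ht.le]
  have hV0 := quadraticRoot_nonneg hH hz B
  set V := quadraticRoot H B z
  have hs : 0 < √t := Real.sqrt_pos.2 ht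
  have hst : √t ^ 2 = t := Real.sq_sqrt ht.le
  have hB := neg_abs_le B
  have hHs : 0 < H * √t := by positivity
  rcases lt_or_ge V (√t) with h | h
  · rw [expStep_of_neg (mul_neg_of_neg_of_pos (by linarith) _)]
    · exact expStep_nonneg _
    · have := abs_nonneg B
      linarith
  · have h1 : H / 2 * (V ^ 2 - t) ≤ (V - √t) * (H * (V + √t) + B) := by
      have : 0 ≤ (V - √t) * (H / 2 * (V + √t) + B) :=
        mul_nonneg (by linarith) (by linarith)
      nlinarith
    have h2 : 0 ≤ H / 2 * (V ^ 2 - t) := by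
      have : √t ^ 2 ≤ V ^ 2 := by gcongr
      exact mul_nonneg (by positivity) (by linarith)
    rw [expStep, expStep, if_pos h2, if_pos (h2.trans h1)]
    exact Real.exp_le_exp.2 (by linarith)

lemma lintegral_expStep_sub_le (hH : 0 < H) (hz : 0 ≤ z) (B : ℝ) :
    ∫⁻ t in Set.Ioi 1, ENNReal.ofReal (expStep (z - (H * t + B * √t))) ≤
      ENNReal.ofReal (2 / H + 4 * B ^ 2 / H ^ 2) := by
  have hV0 := quadraticRoot_nonneg hH hz B
  rcases le_or_gt (2 * |B|) (H * quadraticRoot H B z) with hV | hV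
  · calc _ ≤ ∫⁻ t in Set.Ioi 1,
          ENNReal.ofReal (expStep (H / 2 * (quadraticRoot H B z ^ 2 - t)) * 1) := by
          refine setLIntegral_mono' measurableSet_Ioi fun t ht => ?_
          rw [mul_one]
          exact ENNReal.ofReal_le_ofReal
            (expStep_le_of_two_mul_abs_le hH hz hV (zero_lt_one.trans ht))
      _ ≤ ∫⁻ t, ENNReal.ofReal (expStep (H / 2 * (quadraticRoot H B z ^ 2 - t)) * 1) :=
          setLIntegral_le_lintegral _ _
      _ = ENNReal.ofReal (1 / (H / 2)) := by
          rw [lintegral_sub_left_eq_self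
            (fun r => ENNReal.ofReal (expStep (H / 2 * r) * 1)),
            lintegral_expStep_mul (by positivity) zero_le_one]
      _ ≤ _ := by
          apply ENNReal.ofReal_le_ofReal
          have : 0 ≤ 4 * B ^ 2 / H ^ 2 := by positivity
          have e : 1 / (H / 2) = 2 / H := by field_simp
          linarith
  · have hle : ∀ t ∈ Set.Ioi (1 : ℝ), ENNReal.ofReal (expStep (z - (H * t + B * √t))) ≤
        (Set.Icc 0 (4 * B ^ 2 / H ^ 2)).indicator (fun _ => 1) t := by
      intro t ht
      have ht0 : 0 < t := zero_lt_one.trans ht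
      by_cases hmem : t ∈ Set.Icc 0 (4 * B ^ 2 / H ^ 2)
      · rw [Set.indicator_of_mem hmem]
        exact ENNReal.ofReal_le_one.2 (expStep_le_one _)
      · rw [Set.indicator_of_notMem hmem, sub_eq_of_quadraticRoot hH hz B ht0.le,
          expStep_of_neg, ENNReal.ofReal_zero]
        have ht2 : 4 * B ^ 2 / H ^ 2 < t := by
          by_contra! hcon
          exact hmem ⟨ht0.le, hcon⟩
        have hs : 0 < √t := Real.sqrt_pos.2 ht0
        have hHs : 0 < H * √t := by positivity
        have h1 := mul_quadraticRoot_add_nonneg hH hz B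
        refine mul_neg_of_neg_of_pos ?_ (by linarith)
        rw [sub_neg]
        refine lt_of_lt_of_le (b := 2 * |B| / H) ?_ ?_
        · rw [lt_div_iff₀ hH]
          linarith
        · apply Real.le_sqrt_of_sq_le
          rw [div_pow, mul_pow, sq_abs]
          norm_num
          exact ht2.le
    calc _ ≤ ∫⁻ t in Set.Ioi 1, (Set.Icc 0 (4 * B ^ 2 / H ^ 2)).indicator (fun _ => 1) t :=
          setLIntegral_mono' measurableSet_Ioi hle
      _ ≤ ∫⁻ t, (Set.Icc 0 (4 * B ^ 2 / H ^ 2)).indicator (fun _ => 1) t :=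
          setLIntegral_le_lintegral _ _
      _ = ENNReal.ofReal (4 * B ^ 2 / H ^ 2) := by
          rw [lintegral_indicator measurableSet_Icc, setLIntegral_const, Real.volume_Icc,
            one_mul, sub_zero]
      _ ≤ _ := ENNReal.ofReal_le_ofReal (le_add_of_nonneg_left (by positivity))

end QuadraticRoot

open Filter Topology in
lemma tendsto_lintegral_expStep_mul {H : ℝ} (hH : 0 < H) (B : ℝ) {c : ℝ → ℝ} {C L : ℝ}
    (hc : Measurable c) (hcC : ∀ t, 1 < t → c t ≤ C) (hC : 0 ≤ C) (hL : 0 ≤ L)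
    (hcL : Tendsto c atTop (𝓝 L)) :
    Tendsto (fun z => ∫⁻ t in Set.Ioi 1, ENNReal.ofReal (expStep (z - (H * t + B * √t)) * c t))
      atTop (𝓝 (ENNReal.ofReal (L / H))) := by
  set V := quadraticRoot H B
  have hV : Tendsto V atTop atTop := tendsto_quadraticRoot hH B
  set F : ℝ → ℝ → ENNReal := fun z t => (Set.Ioi (1 : ℝ)).indicator
    (fun t => ENNReal.ofReal (expStep (z - (H * t + B * √t)) * c t)) t with hF
  have hFm : ∀ z, Measurable (F z) := by
    intro z
    refine Measurable.indicator (Measurable.ennreal_ofReal (Measurable.mul ?_ hc))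
      measurableSet_Ioi
    exact measurable_expStep.comp (by fun_prop)
  have key : ∀ z, ∫⁻ t in Set.Ioi 1, ENNReal.ofReal (expStep (z - (H * t + B * √t)) * c t) =
      ∫⁻ r, F z (V z ^ 2 - r) := by
    intro z
    rw [lintegral_sub_left_eq_self (F z), hF, lintegral_indicator measurableSet_Ioi]
  simp_rw [key]
  rw [← lintegral_expStep_mul hH hL]
  refine tendsto_lintegral_filter_of_dominated_convergence
    (fun r => ENNReal.ofReal (expStep (H / 2 * r) * C))
    (Eventually.of_forall fun z => (hFm z).comp (by fun_prop)) ?_ ?_ ?_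
  · filter_upwards [eventually_ge_atTop 0,
      (hV.const_mul_atTop hH).eventually_ge_atTop (2 * |B|)] with z hz hVz
    refine Eventually.of_forall fun r => ?_
    by_cases hr : 1 < V z ^ 2 - r
    · simp only [hF]
      rw [Set.indicator_of_mem (Set.mem_Ioi.2 hr)]
      apply ENNReal.ofReal_le_ofReal
      have h1 := expStep_le_of_two_mul_abs_le hH hz hVz (zero_lt_one.trans hr)
      have e : quadraticRoot H B z ^ 2 - (V z ^ 2 - r) = r := by simp only [V]; ring
      rw [e] at h1
      calc _ ≤ expStep (z - (H * (V z ^ 2 - r) + B * √(V z ^ 2 - r))) * C :=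
            mul_le_mul_of_nonneg_left (hcC _ hr) (expStep_nonneg _)
        _ ≤ _ := mul_le_mul_of_nonneg_right h1 hC
    · simp only [hF]
      rw [Set.indicator_of_notMem (by simpa using hr)]
      exact zero_le
  · rw [lintegral_expStep_mul (by positivity) hC]
    exact ENNReal.ofReal_ne_top
  · have hne : ∀ᵐ r : ℝ, r ≠ 0 := by simp [ae_iff]
    filter_upwards [hne] with r hr
    have ht : Tendsto (fun z => V z ^ 2 - r) atTop atTop :=
      tendsto_atTop_add_const_right _ (-r) ((tendsto_pow_atTop two_ne_zero).comp hV)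
    have hs : Tendsto (fun z => V z + √(V z ^ 2 - r)) atTop atTop :=
      hV.atTop_add_atTop (Real.tendsto_sqrt_atTop.comp ht)
    have harg : Tendsto (fun z => z - (H * (V z ^ 2 - r) + B * √(V z ^ 2 - r))) atTop
        (𝓝 (H * r)) := by
      have h0 : Tendsto (fun z => H * r + B * (r / (V z + √(V z ^ 2 - r)))) atTop
          (𝓝 (H * r + B * 0)) :=
        tendsto_const_nhds.add ((tendsto_const_nhds.div_atTop hs).const_mul B)
      rw [mul_zero, add_zero] at h0
      refine h0.congr' ?_
      filter_upwards [eventually_ge_atTop 0, ht.eventually_ge_atTop 0, hs.eventually_gt_atTop 0]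
        with z hz htz hsz
      have hsq : √(V z ^ 2 - r) ^ 2 = V z ^ 2 - r := Real.sq_sqrt htz
      rw [sub_eq_of_quadraticRoot hH hz B htz]
      change _ = (V z - √(V z ^ 2 - r)) * (H * (V z + √(V z ^ 2 - r)) + B)
      have hr' : r / (V z + √(V z ^ 2 - r)) = V z - √(V z ^ 2 - r) := by
        rw [div_eq_iff hsz.ne']
        linear_combination hsq
      rw [hr']
      linear_combination H * hsq
    have hg := (continuousAt_expStep (mul_ne_zero hH.ne' hr)).tendsto.comp harg
    have hfin := ENNReal.tendsto_ofReal (hg.mul (hcL.comp ht))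
    refine hfin.congr' ?_
    filter_upwards [ht.eventually_gt_atTop 1] with z hz
    simp only [hF]
    rw [Set.indicator_of_mem (Set.mem_Ioi.2 hz)]
    rfl

lemma measurable_rescaledPoisson (p : ℝ) :
    Measurable fun q : ℝ × ℝ => rescaledPoisson p q.1 q.2 := by
  unfold rescaledPoisson
  exact Measurable.mul (by fun_prop) (measurable_poissonWeight.comp
    (f := fun q : ℝ × ℝ => (p * (q.1 - 1), p * (q.1 - 1) + √q.1 * q.2)) (by fun_prop))

lemma lintegral_eq_lintegral_add_smul {ι : Type*} [Fintype ι] {F : (ι → ℝ) → ENNReal}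
    (hF : Measurable F) (b : ι → ℝ) {R : ℝ} (hR : 0 < R) :
    ∫⁻ x, F x = ∫⁻ y, ENNReal.ofReal (R ^ Fintype.card ι) * F (b + R • y) := by
  have hF' : Measurable fun x => F (b + x) := hF.comp (by fun_prop)
  have hR' : Measurable fun y : ι → ℝ => F (b + R • y) := hF.comp (by fun_prop)
  have hmap := lintegral_map (μ := volume) hF' (by fun_prop : Measurable fun y : ι → ℝ => R • y)
  rw [lintegral_const_mul _ hR', ← hmap, Measure.map_addHaar_smul _ hR.ne', lintegral_smul_measure,
    lintegral_add_left_eq_self F b, Module.finrank_fintype_fun_eq_card, smul_eq_mul,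
    ← mul_assoc, ← ENNReal.ofReal_mul (by positivity), abs_of_pos (by positivity),
    mul_inv_cancel₀ (by positivity), ENNReal.ofReal_one, one_mul]

lemma integrable_exp_neg_abs_mul {b : ℝ} (hb : 0 < b) :
    Integrable fun y : ℝ => Real.exp (-(b * |y|)) := by
  rw [← integrableOn_univ, ← Set.Iic_union_Ioi (a := (0 : ℝ))]
  refine IntegrableOn.union ?_ ?_
  · refine (integrableOn_exp_mul_Iic hb 0).congr_fun (fun y hy => ?_) measurableSet_Iic
    simp only [abs_of_nonpos (Set.mem_Iic.1 hy)]
    congr 1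
    ring
  · refine (integrableOn_exp_mul_Ioi (neg_neg_of_pos hb) 0).congr_fun (fun y hy => ?_)
      measurableSet_Ioi
    simp only [abs_of_pos (Set.mem_Ioi.1 hy)]
    congr 1
    ring

section Multinomial

variable {n : ℕ} {a : Fin n → ℝ}

lemma prod_poissonWeight_eq (hsum : ∑ i, Real.exp (-a i) = 1) {u : ℝ} (hu : 0 < u)
    {x : Fin n → ℝ} (hx : ∀ i, 0 ≤ x i) :
    ∏ i, poissonWeight (Real.exp (-a i) * u) (x i) =
      Real.exp (-u) * u ^ (∑ i, x i + 1 - 1) *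
        (Real.exp (-∑ i, a i * x i) / ∏ i, Real.Gamma (x i + 1)) := by
  have h : ∀ i, poissonWeight (Real.exp (-a i) * u) (x i) =
      Real.exp (-(Real.exp (-a i) * u)) * (Real.exp (-(a i * x i)) * u ^ x i) /
        Real.Gamma (x i + 1) := by
    intro i
    rw [poissonWeight, if_pos (hx i), Real.mul_rpow (by positivity) hu.le, ← Real.exp_mul,
      neg_mul]
  simp_rw [h]
  rw [Finset.prod_div_distrib, Finset.prod_mul_distrib, Finset.prod_mul_distrib,
    ← Real.exp_sum, ← Real.exp_sum, ← Real.rpow_sum_of_pos hu, Finset.sum_neg_distrib,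
    Finset.sum_neg_distrib, ← Finset.sum_mul, hsum, one_mul, add_sub_cancel_right]
  ring

lemma ofReal_multinomial_eq_lintegral (hsum : ∑ i, Real.exp (-a i) = 1)
    {x : Fin n → ℝ} (hx : ∀ i, 0 ≤ x i) :
    ENNReal.ofReal (Real.Gamma (∑ i, x i + 1) / (∏ i, Real.Gamma (x i + 1)) *
        Real.exp (-∑ i, a i * x i)) =
      ∫⁻ t in Set.Ioi 1, ENNReal.ofReal
        (∏ i, poissonWeight (Real.exp (-a i) * (t - 1)) (x i)) := by
  have hs : 0 < ∑ i, x i + 1 := by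
    have := Finset.sum_nonneg fun i (_ : i ∈ Finset.univ) => hx i
    linarith
  have hG : 0 < ∏ i, Real.Gamma (x i + 1) :=
    Finset.prod_pos fun i _ => Real.Gamma_pos_of_pos (by linarith [hx i])
  have hshift : ∫⁻ t in Set.Ioi 1, ENNReal.ofReal
        (∏ i, poissonWeight (Real.exp (-a i) * (t - 1)) (x i)) =
      ∫⁻ u in Set.Ioi 0, ENNReal.ofReal (∏ i, poissonWeight (Real.exp (-a i) * u) (x i)) := by
    rw [← lintegral_indicator measurableSet_Ioi, ← lintegral_indicator measurableSet_Ioi,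
      ← lintegral_sub_right_eq_self ((Set.Ioi (0 : ℝ)).indicator _) (1 : ℝ)]
    refine lintegral_congr fun t => ?_
    by_cases ht : 1 < t
    · rw [Set.indicator_of_mem (Set.mem_Ioi.2 ht), Set.indicator_of_mem (by simpa using ht)]
    · rw [Set.indicator_of_notMem (by simpa using ht),
        Set.indicator_of_notMem (by simpa using ht)]
  rw [hshift, setLIntegral_congr_fun measurableSet_Ioi fun u hu =>
    congrArg ENNReal.ofReal (prod_poissonWeight_eq hsum hu hx),
    ← ofReal_integral_eq_lintegral_ofReal ((Real.GammaIntegral_convergent hs).mul_const _),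
    integral_mul_const, ← Real.Gamma_eq_integral hs]
  · congr 1
    ring
  · refine (ae_restrict_mem measurableSet_Ioi).mono fun u hu => ?_
    have hu' : (0 : ℝ) < u := hu
    simp only [Pi.zero_apply]
    positivity

lemma integral_multinomial_div_exp_eq_toReal
    (hsum : ∑ i, Real.exp (-a i) = 1) (z : ℝ) :
    (∫ x in {x : Fin n → ℝ | (∀ i, 0 ≤ x i) ∧ ∑ i, a i * x i ≤ z},
        Real.Gamma ((∑ i, x i) + 1) / ∏ i, Real.Gamma (x i + 1)) / Real.exp z =
      (∫⁻ x : Fin n → ℝ, ∫⁻ t in Set.Ioi 1, ENNReal.ofReal (expStep (z - ∑ i, a i * x i) *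
        ∏ i, poissonWeight (Real.exp (-a i) * (t - 1)) (x i))).toReal := by
  have hmS : MeasurableSet {x : Fin n → ℝ | (∀ i, 0 ≤ x i) ∧ ∑ i, a i * x i ≤ z} := by
    have e : {x : Fin n → ℝ | (∀ i, 0 ≤ x i) ∧ ∑ i, a i * x i ≤ z} =
        (⋂ i, {x : Fin n → ℝ | 0 ≤ x i}) ∩ {x | ∑ i, a i * x i ≤ z} := by
      ext x; simp
    rw [e]
    exact (MeasurableSet.iInter fun i => measurableSet_le (by fun_prop) (by fun_prop)).inter
      (measurableSet_le (by fun_prop) (by fun_prop))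
  have hM : Measurable fun x : Fin n → ℝ =>
      Real.Gamma ((∑ i, x i) + 1) / (∏ i, Real.Gamma (x i + 1)) / Real.exp z := by
    refine Measurable.div_const (Measurable.div (measurable_Gamma_real.comp (by fun_prop)) ?_) _
    exact Finset.measurable_fun_prod _ fun i _ => measurable_Gamma_real.comp (by fun_prop)
  have hnn : ∀ x : Fin n → ℝ, (∀ i, 0 ≤ x i) →
      0 ≤ Real.Gamma ((∑ i, x i) + 1) / ∏ i, Real.Gamma (x i + 1) := by
    intro x hx
    have hs : 0 < ∑ i, x i + 1 := by
      have := Finset.sum_nonneg fun i (_ : i ∈ Finset.univ) => hx i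
      linarith
    exact div_nonneg (Real.Gamma_pos_of_pos hs).le
      (Finset.prod_nonneg fun i _ => (Real.Gamma_pos_of_pos (by linarith [hx i])).le)
  rw [← integral_div, integral_eq_lintegral_of_nonneg_ae
    ((ae_restrict_mem hmS).mono fun x hx => div_nonneg (hnn x hx.1) (Real.exp_pos z).le)
    hM.aestronglyMeasurable, ← lintegral_indicator hmS]
  congr 1
  refine lintegral_congr fun x => ?_
  by_cases hx : ∀ i, 0 ≤ x i
  · have hin : ∫⁻ t in Set.Ioi 1, ENNReal.ofReal (expStep (z - ∑ i, a i * x i) *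
        ∏ i, poissonWeight (Real.exp (-a i) * (t - 1)) (x i)) =
        ENNReal.ofReal (expStep (z - ∑ i, a i * x i)) *
        ENNReal.ofReal (Real.Gamma (∑ i, x i + 1) / (∏ i, Real.Gamma (x i + 1)) *
          Real.exp (-∑ i, a i * x i)) := by
      rw [ofReal_multinomial_eq_lintegral hsum hx,
        ← lintegral_const_mul' _ _ ENNReal.ofReal_ne_top]
      exact lintegral_congr fun t => ENNReal.ofReal_mul (expStep_nonneg _)
    rw [hin]
    by_cases hz : ∑ i, a i * x i ≤ z
    · have hxS : x ∈ {x : Fin n → ℝ | (∀ i, 0 ≤ x i) ∧ ∑ i, a i * x i ≤ z} := ⟨hx, hz⟩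
      rw [Set.indicator_of_mem hxS, expStep, if_pos (by linarith),
        ← ENNReal.ofReal_mul (by positivity)]
      congr 1
      rw [mul_left_comm, ← Real.exp_add, div_eq_mul_inv, ← Real.exp_neg]
      congr 2
      ring
    · rw [Set.indicator_of_notMem (fun h => hz h.2), expStep_of_neg (by linarith),
        ENNReal.ofReal_zero, zero_mul]
  · rw [Set.indicator_of_notMem (fun h => hx h.1)]
    push Not at hx
    obtain ⟨j, hj⟩ := hx
    have h0 : ∀ t : ℝ, ∏ i, poissonWeight (Real.exp (-a i) * (t - 1)) (x i) = 0 := fun t =>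
      Finset.prod_eq_zero (Finset.mem_univ j) (poissonWeight_of_neg _ hj)
    simp [h0]

lemma lintegral_expStep_mul_poissonWeight (z : ℝ) {t : ℝ} (ht : 1 < t) :
    ∫⁻ x : Fin n → ℝ, ENNReal.ofReal (expStep (z - ∑ i, a i * x i) *
        ∏ i, poissonWeight (Real.exp (-a i) * (t - 1)) (x i)) =
      ∫⁻ y : Fin n → ℝ, ENNReal.ofReal
        (expStep (z + ∑ i, a i * Real.exp (-a i) -
          ((∑ i, a i * Real.exp (-a i)) * t + (∑ i, a i * y i) * √t)) *
        ∏ i, rescaledPoisson (Real.exp (-a i)) t (y i)) := by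
  have hst : 0 < √t := Real.sqrt_pos.2 (by linarith)
  have hmeas : Measurable fun x : Fin n → ℝ => ENNReal.ofReal (expStep (z - ∑ i, a i * x i) *
        ∏ i, poissonWeight (Real.exp (-a i) * (t - 1)) (x i)) := by
    refine Measurable.ennreal_ofReal (Measurable.mul (measurable_expStep.comp (by fun_prop)) ?_)
    exact Finset.measurable_fun_prod _ fun i _ => measurable_poissonWeight.comp
      (f := fun x : Fin n → ℝ => (Real.exp (-a i) * (t - 1), x i)) (by fun_prop)
  rw [lintegral_eq_lintegral_add_smul hmeas (fun i => Real.exp (-a i) * (t - 1)) hst]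
  refine lintegral_congr fun y => ?_
  rw [← ENNReal.ofReal_mul (by positivity)]
  congr 1
  simp only [Pi.add_apply, Pi.smul_apply, smul_eq_mul, rescaledPoisson]
  rw [Finset.prod_mul_distrib, Finset.prod_const, Finset.card_univ, mul_left_comm]
  congr 2
  have e : ∑ i, a i * (Real.exp (-a i) * (t - 1) + √t * y i) =
      (∑ i, a i * Real.exp (-a i)) * (t - 1) + (∑ i, a i * y i) * √t := by
    rw [Finset.sum_mul, Finset.sum_mul, ← Finset.sum_add_distrib]
    exact Finset.sum_congr rfl fun i _ => by ring
  rw [e]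
  ring

lemma lintegral_multinomial_eq (z : ℝ) :
    ∫⁻ x : Fin n → ℝ, ∫⁻ t in Set.Ioi 1, ENNReal.ofReal (expStep (z - ∑ i, a i * x i) *
        ∏ i, poissonWeight (Real.exp (-a i) * (t - 1)) (x i)) =
      ∫⁻ y : Fin n → ℝ, ∫⁻ t in Set.Ioi 1, ENNReal.ofReal
        (expStep (z + ∑ i, a i * Real.exp (-a i) -
          ((∑ i, a i * Real.exp (-a i)) * t + (∑ i, a i * y i) * √t)) *
        ∏ i, rescaledPoisson (Real.exp (-a i)) t (y i)) := by
  rw [lintegral_lintegral_swap, setLIntegral_congr_fun measurableSet_Ioi fun t ht =>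
    lintegral_expStep_mul_poissonWeight z ht, lintegral_lintegral_swap]
  · refine (Measurable.ennreal_ofReal (Measurable.mul (measurable_expStep.comp ?_) ?_)).aemeasurable
    · fun_prop
    · exact Finset.measurable_fun_prod _ fun i _ => (measurable_rescaledPoisson _).comp
        (f := fun q : ℝ × (Fin n → ℝ) => (q.1, q.2 i)) (by fun_prop)
  · refine (Measurable.ennreal_ofReal (Measurable.mul (measurable_expStep.comp ?_) ?_)).aemeasurable
    · fun_prop
    · exact Finset.measurable_fun_prod _ fun i _ => measurable_poissonWeight.comp
        (f := fun q : (Fin n → ℝ) × ℝ => (Real.exp (-a i) * (q.2 - 1), q.1 i)) (by fun_prop)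

lemma two_div_add_sq_le_exp {H : ℝ} (hH : 0 < H) (ha : ∀ i, 0 < a i) (y : Fin n → ℝ) :
    2 / H + 4 * (∑ i, a i * y i) ^ 2 / H ^ 2 ≤
      (2 / H + 128 * (∑ i, a i) ^ 2 / H ^ 2) * ∏ i, Real.exp (|y i| / 4) := by
  rw [← Real.exp_sum, ← Finset.sum_div]
  set w := ∑ i, |y i| with hw
  have hw0 : 0 ≤ w := Finset.sum_nonneg fun i _ => abs_nonneg _
  have hA0 : 0 ≤ ∑ i, a i := Finset.sum_nonneg fun i _ => (ha i).le
  have hB : |∑ i, a i * y i| ≤ (∑ i, a i) * w := by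
    refine (Finset.abs_sum_le_sum_abs _ _).trans ?_
    rw [Finset.sum_mul]
    refine Finset.sum_le_sum fun i _ => ?_
    rw [abs_mul, abs_of_pos (ha i)]
    exact mul_le_mul_of_nonneg_left
      (Finset.single_le_sum (f := fun i => |y i|) (fun j _ => abs_nonneg _) (Finset.mem_univ i))
      (ha i).le
  have hB2 : (∑ i, a i * y i) ^ 2 ≤ (∑ i, a i) ^ 2 * w ^ 2 := by
    rw [← mul_pow, ← sq_abs]
    gcongr
  have he := Real.quadratic_le_exp_of_nonneg (x := w / 4) (by positivity)
  have h1 : 1 ≤ Real.exp (w / 4) := Real.one_le_exp (by positivity)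
  have hw2 : w ^ 2 ≤ 32 * Real.exp (w / 4) := by nlinarith
  have h2 : 2 / H ≤ 2 / H * Real.exp (w / 4) := le_mul_of_one_le_right (by positivity) h1
  have h3 : 4 * (∑ i, a i * y i) ^ 2 / H ^ 2 ≤
      128 * (∑ i, a i) ^ 2 / H ^ 2 * Real.exp (w / 4) := by
    rw [div_mul_eq_mul_div, div_le_div_iff_of_pos_right (by positivity)]
    have := mul_le_mul_of_nonneg_left hw2 (sq_nonneg (∑ i, a i))
    linarith
  linarith

open Filter Topology in
lemma tendsto_lintegral_rescaledPoisson (ha : ∀ i, 0 < a i)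
    {H : ℝ} (hH : 0 < H) :
    Tendsto (fun z => ∫⁻ y : Fin n → ℝ, ∫⁻ t in Set.Ioi 1, ENNReal.ofReal
        (expStep (z - (H * t + (∑ i, a i * y i) * √t)) *
          ∏ i, rescaledPoisson (Real.exp (-a i)) t (y i)))
      atTop (𝓝 (ENNReal.ofReal (1 / H))) := by
  have hp1 : ∀ i, Real.exp (-a i) ≤ 1 := fun i => Real.exp_le_one_iff.2 (by linarith [ha i])
  choose C hC0 hC using fun i => exists_rescaledPoisson_le (Real.exp_pos (-a i)) (hp1 i)
  have hnn : ∀ (t : ℝ), 1 < t → ∀ y : Fin n → ℝ,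
      0 ≤ ∏ i, rescaledPoisson (Real.exp (-a i)) t (y i) := fun t ht y =>
    Finset.prod_nonneg fun i _ => rescaledPoisson_nonneg (Real.exp_pos _).le ht.le _
  have hprod : ∀ (t : ℝ), 1 < t → ∀ y : Fin n → ℝ,
      ∏ i, rescaledPoisson (Real.exp (-a i)) t (y i) ≤ ∏ i, (C i * Real.exp (-(|y i| / 2))) :=
    fun t ht y => Finset.prod_le_prod
      (fun i _ => rescaledPoisson_nonneg (Real.exp_pos _).le ht.le _) fun i _ => hC i t _ ht
  have hCnn : ∀ y : Fin n → ℝ, 0 ≤ ∏ i, (C i * Real.exp (-(|y i| / 2))) := fun y =>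
    Finset.prod_nonneg fun i _ => (mul_pos (hC0 i) (Real.exp_pos _)).le
  have hgint : Integrable fun y : Fin n → ℝ => ∏ i, gaussianDensity (Real.exp (-a i)) (y i) :=
    Integrable.fintype_prod fun i => integrable_gaussianDensity (Real.exp_pos _)
  have hlim : ∫⁻ y : Fin n → ℝ,
      ENNReal.ofReal ((∏ i, gaussianDensity (Real.exp (-a i)) (y i)) / H) =
      ENNReal.ofReal (1 / H) := by
    rw [← ofReal_integral_eq_lintegral_ofReal (hgint.div_const H)
      (Eventually.of_forall fun y =>
        div_nonneg (Finset.prod_nonneg fun i _ => gaussianDensity_nonneg _ _) hH.le),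
      integral_div, integral_fintype_prod_volume_eq_prod fun i => gaussianDensity (Real.exp (-a i))]
    simp_rw [integral_gaussianDensity (Real.exp_pos _)]
    rw [Finset.prod_const_one]
  rw [← hlim]
  set K := 2 / H + 128 * (∑ i, a i) ^ 2 / H ^ 2 with hK
  refine tendsto_lintegral_filter_of_dominated_convergence
    (fun y => ENNReal.ofReal (K * ∏ i, (C i * Real.exp (-(1 / 4 * |y i|)))))
    (Eventually.of_forall fun z => ?_) ?_ ?_ ?_
  · refine Measurable.lintegral_prod_right'
      (f := fun q : (Fin n → ℝ) × ℝ => ENNReal.ofReal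
        (expStep (z - (H * q.2 + (∑ i, a i * q.1 i) * √q.2)) *
          ∏ i, rescaledPoisson (Real.exp (-a i)) q.2 (q.1 i)))
      (Measurable.ennreal_ofReal (Measurable.mul (measurable_expStep.comp ?_) ?_))
    · fun_prop
    · exact Finset.measurable_fun_prod _ fun i _ => (measurable_rescaledPoisson _).comp
        (f := fun q : (Fin n → ℝ) × ℝ => (q.2, q.1 i)) (by fun_prop)
  · filter_upwards [eventually_ge_atTop 0] with z hz
    refine Eventually.of_forall fun y => ?_
    calc _ ≤ ∫⁻ t in Set.Ioi 1, ENNReal.ofReal (∏ i, (C i * Real.exp (-(|y i| / 2)))) *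
          ENNReal.ofReal (expStep (z - (H * t + (∑ i, a i * y i) * √t))) := by
          refine setLIntegral_mono' measurableSet_Ioi fun t ht => ?_
          rw [← ENNReal.ofReal_mul (hCnn y), mul_comm]
          exact ENNReal.ofReal_le_ofReal
            (mul_le_mul_of_nonneg_right (hprod t ht y) (expStep_nonneg _))
      _ = ENNReal.ofReal (∏ i, (C i * Real.exp (-(|y i| / 2)))) *
          ∫⁻ t in Set.Ioi 1, ENNReal.ofReal (expStep (z - (H * t + (∑ i, a i * y i) * √t))) :=
          lintegral_const_mul' _ _ ENNReal.ofReal_ne_top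
      _ ≤ ENNReal.ofReal (∏ i, (C i * Real.exp (-(|y i| / 2)))) *
          ENNReal.ofReal (K * ∏ i, Real.exp (|y i| / 4)) :=
          mul_le_mul_right ((lintegral_expStep_sub_le hH hz _).trans
            (ENNReal.ofReal_le_ofReal (two_div_add_sq_le_exp hH ha y))) _
      _ = _ := by
          rw [← ENNReal.ofReal_mul (hCnn y), mul_left_comm, ← Finset.prod_mul_distrib]
          congr 2
          refine Finset.prod_congr rfl fun i _ => ?_
          rw [mul_assoc, ← Real.exp_add]
          congr 2
          ring
  · have hint : Integrable fun y : Fin n → ℝ =>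
        K * ∏ i, (C i * Real.exp (-(1 / 4 * |y i|))) :=
      (Integrable.fintype_prod (f := fun i y => C i * Real.exp (-(1 / 4 * |y|))) fun i =>
        (integrable_exp_neg_abs_mul (by norm_num)).const_mul (C i)).const_mul K
    exact hint.lintegral_lt_top.ne
  · refine Eventually.of_forall fun y => ?_
    refine tendsto_lintegral_expStep_mul hH _ ?_ (fun t ht => hprod t ht y) (hCnn y)
      (Finset.prod_nonneg fun i _ => gaussianDensity_nonneg _ _)
      (tendsto_finsetProd _ fun i _ => tendsto_rescaledPoisson (Real.exp_pos _) _)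
    exact Finset.measurable_fun_prod _ fun i _ => (measurable_rescaledPoisson _).comp
      (f := fun t : ℝ => (t, y i)) (by fun_prop)

end Multinomial

/-- Integral analogue of the main theorem: with
`M x = Γ(∑ x i + 1)/∏ Γ(x i + 1)` and `f z = ∫_{S(z)} M`,
`f(z)/e^z → 1/H(p)`. -/
theorem integral_multinomial_asymptotics (n : ℕ) (hn : 2 ≤ n) (a : Fin n → ℝ)
    (ha : ∀ i, 0 < a i) (hsum : ∑ i, Real.exp (-a i) = 1) :
    Filter.Tendsto
      (fun z : ℝ =>
        (∫ x in {x : Fin n → ℝ | (∀ i, 0 ≤ x i) ∧ ∑ i, a i * x i ≤ z},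
            Real.Gamma ((∑ i, x i) + 1) / ∏ i, Real.Gamma (x i + 1))
          / Real.exp z)
      Filter.atTop (nhds (1 / ∑ i, a i * Real.exp (-a i))) := by
  have hH : 0 < ∑ i, a i * Real.exp (-a i) :=
    Finset.sum_pos (fun i _ => mul_pos (ha i) (Real.exp_pos _))
      ⟨⟨0, by lia⟩, Finset.mem_univ _⟩
  simp_rw [integral_multinomial_div_exp_eq_toReal hsum, lintegral_multinomial_eq]
  have h := (ENNReal.tendsto_toReal ENNReal.ofReal_ne_top).comp
    ((tendsto_lintegral_rescaledPoisson ha hH).comp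
      (Filter.tendsto_atTop_add_const_right _ (∑ i, a i * Real.exp (-a i)) Filter.tendsto_id))
  rwa [ENNReal.toReal_ofReal (by positivity)] at h
end
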